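/- Let Γ = (S, Act, P) be a finite MDP that is clean with respect to a parity objective φ and with respect to target sets F_1, …, F_n ⊆ S, let s ∈ S and p ∈ [0,1]^n. If there exists any strategy σ with Γ, σ, s ⊨ S(φ) ∧ ⋀_{i=1}^n Pr_{≥p_i}(◇F_i), then there also exists a finite-memory strategy σ' with Γ, σ', s ⊨ S(φ) ∧ ⋀_{i=1}^n Pr_{≥p_i}(◇F_i). (Strategy-complexity content of Theorem 6 on sure parity and n non-strict reachability thresholds.) -/

import Mathlib

open MeasureTheory ENNReal
open scoped Classical

/-! ### Markov chains on countable state spaces and their path measures -/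

/-- The product σ-algebra on infinite paths over a (discrete) state space `T`. -/
noncomputable def pathsMS (T : Type*) : MeasurableSpace (ℕ → T) :=
  @MeasurableSpace.pi ℕ (fun _ => T) (fun _ => ⊤)

/-- The cylinder set of all paths agreeing with `π` on the first `k+1` states. -/
def Cyl {T : Type*} (π : ℕ → T) (k : ℕ) : Set (ℕ → T) := {ω | ∀ i ≤ k, ω i = π i}

/-- `μ` is the path measure of the Markov chain with transition probabilities `P`
and initial state `s`: it is a probability measure assigning to each cylinder set the
product of the transition probabilities along its prefix. -/
def IsPathMeasure {T : Type*} (P : T → T → ℝ≥0∞) (s : T)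
    (μ : @Measure (ℕ → T) (pathsMS T)) : Prop :=
  μ Set.univ = 1 ∧
  ∀ (π : ℕ → T) (k : ℕ),
    μ (Cyl π k) = if π 0 = s then ∏ i ∈ Finset.range k, P (π i) (π (i + 1)) else 0

/-- The path measure `Pr^M_s` of a Markov chain (it exists and is unique by the
Ionescu–Tulcea/Carathéodory theorems; here it is taken by definite description). -/
noncomputable def pathMeasure {T : Type*} (P : T → T → ℝ≥0∞) (s : T) :
    @Measure (ℕ → T) (pathsMS T) :=
  if h : ∃ μ, IsPathMeasure P s μ then h.choose else 0

/-- `Paths^M_s`: infinite sequences starting at `s` all of whose steps have positive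
transition probability. -/
def PathsFrom {T : Type*} (P : T → T → ℝ≥0∞) (s : T) : Set (ℕ → T) :=
  {ω | ω 0 = s ∧ ∀ i, 0 < P (ω i) (ω (i + 1))}

/-! ### MDPs, strategies, objectives -/

/-- A finite Markov decision process: transition probabilities `P s a s'` such that
for each state-action pair the total mass is `0` or `1` (the action is *enabled* at `s`
in the latter case), and every state has an enabled action. -/
structure MDP (S Act : Type) [Fintype S] [Nonempty S] [Fintype Act] [Nonempty Act] where
  P : S → Act → S → ℝ≥0∞
  sum_mem : ∀ s a, (∑ s', P s a s') = 0 ∨ (∑ s', P s a s') = 1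
  exists_enabled : ∀ s, ∃ a, (∑ s', P s a s') = 1

variable {S Act : Type} [Fintype S] [Nonempty S] [Fintype Act] [Nonempty Act]

/-- A strategy: a machine with countable memory `Q`, initial mode `init`,
deterministic memory update `next`, and output distributions `out` supported on
enabled actions. -/
structure Strategy (M : MDP S Act) where
  Q : Type
  countable : Countable Q
  init : Q
  next : Q → S → Q
  out : Q → S → Act → ℝ≥0∞
  out_sum : ∀ q s, (∑ a, out q s a) = 1
  out_enabled : ∀ q s a, out q s a ≠ 0 → (∑ s', M.P s a s') = 1

/-- A strategy is finite-memory if its memory set is finite. -/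
def Strategy.FiniteMemory {M : MDP S Act} (σ : Strategy M) : Prop := Finite σ.Q

/-- The transition probabilities of the Markov chain `Γ^σ` induced by strategy `σ`
on the state space `S × Q`. -/
noncomputable def MDP.step (M : MDP S Act) (σ : Strategy M) : S × σ.Q → S × σ.Q → ℝ≥0∞ :=
  fun x y => if σ.next x.2 x.1 = y.2 then ∑ a, σ.out x.2 x.1 a * M.P x.1 a y.1 else 0

/-- Lifting an objective over `S` to paths over `S × Q` via the first component. -/
def liftObj {T Q : Type*} (Ω : Set (ℕ → T)) : Set (ℕ → T × Q) :=
  {ω | (fun i => (ω i).1) ∈ Ω}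

/-- `Pr^{Γ^σ}_{(s,q_ι)}(Ω)`: the probability of the (lifted) objective `Ω` in the
Markov chain induced by `σ` started at `(s, σ.init)`. -/
noncomputable def MDP.Pr (M : MDP S Act) (σ : Strategy M) (s : S) (Ω : Set (ℕ → S)) : ℝ≥0∞ :=
  pathMeasure (M.step σ) (s, σ.init) (liftObj Ω)

/-- `Γ, σ, s ⊨ S(Ω)`: every path of the induced Markov chain from `(s, σ.init)`
(surely) satisfies the lifted objective `Ω`. -/
def MDP.Sure (M : MDP S Act) (σ : Strategy M) (s : S) (Ω : Set (ℕ → S)) : Prop :=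
  PathsFrom (M.step σ) (s, σ.init) ⊆ liftObj Ω

/-- The reachability objective `◇F`. -/
def ReachObj {T : Type*} (F : Set T) : Set (ℕ → T) := {π | ∃ k, π k ∈ F}

/-- The set of states occurring infinitely often on a path. -/
def InfOft {T : Type*} (π : ℕ → T) : Set T := {s | ∀ i, ∃ j, i ≤ j ∧ π j = s}

/-- The parity objective for the priority function `φ`: the maximal priority occurring
infinitely often is even. -/
def ParityObj {T : Type*} (φ : T → ℕ) : Set (ℕ → T) := {π | Even (sSup (φ '' InfOft π))}

/-- A state is a sink if every enabled action loops with probability 1. -/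
def MDP.IsSink (M : MDP S Act) (s : S) : Prop :=
  ∀ a, (∑ s', M.P s a s') = 1 → M.P s a s = 1

/-- `Γ` is clean w.r.t. the parity objective `φ`: from every state some strategy
surely satisfies `φ`. -/
def MDP.CleanParity (M : MDP S Act) (φ : S → ℕ) : Prop :=
  ∀ s, ∃ σ : Strategy M, M.Sure σ s (ParityObj φ)

/-- `Γ` is clean w.r.t. the target sets `F 1, …, F n`: every target state is a sink and
from every state some strategy reaches `F = ⋃ i, F i` with probability 1. -/
def MDP.CleanTargets (M : MDP S Act) {n : ℕ} (F : Fin n → Set S) : Prop :=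
  (∀ s ∈ ⋃ i, F i, M.IsSink s) ∧
  ∀ s, ∃ σ : Strategy M, 1 ≤ M.Pr σ s (ReachObj (⋃ i, F i))

section PathMeasure
open ProbabilityTheory

theorem exists_pathMeasure {T : Type} [Countable T] (P : T → T → ℝ≥0∞)
    (hP : ∀ x, ∑' y, P x y = 1) (s : T) : ∃ μ, IsPathMeasure P s μ := by
  let mT : MeasurableSpace T := ⊤
  have : DiscreteMeasurableSpace T := ⟨fun _ => trivial⟩
  let pm : T → PMF T := fun x => ⟨P x, by rw [← hP x]; exact ENNReal.summable.hasSum⟩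
  let κ : (n : ℕ) → Kernel (Π _ : Finset.Iic n, T) T := fun n =>
    Kernel.ofFunOfCountable (fun f => (pm (f ⟨n, by simp⟩)).toMeasure)
  have : ∀ n, IsMarkovKernel (κ n) := fun n => ⟨fun f => by
    change IsProbabilityMeasure (pm (f ⟨n, by simp⟩)).toMeasure; infer_instance⟩
  have hκ : ∀ n f y, κ n f {y} = P (f ⟨n, by simp⟩) y := by
    intro n f y
    change (pm (f ⟨n, by simp⟩)).toMeasure {y} = _
    rw [PMF.toMeasure_apply_singleton _ _ (measurableSet_singleton y)]
    rfl
  let μ : Measure (ℕ → T) := Kernel.trajMeasure (X := fun _ => T) (Measure.dirac s) κ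
  have : IsProbabilityMeasure μ := by
    show IsProbabilityMeasure (Kernel.trajMeasure (X := fun _ => T) (Measure.dirac s) κ)
    infer_instance
  have hcyl : ∀ (π : ℕ → T) (k : ℕ), Cyl π k =
      (Preorder.frestrictLe (π := fun _ => T) k) ⁻¹' {fun i : Finset.Iic k => π i} := by
    intro π k
    ext ω
    simp only [Cyl, Set.mem_ofPred_eq, Set.mem_preimage, Set.mem_singleton_iff]
    constructor
    · intro h; funext i; exact h i (Finset.mem_Iic.1 i.2)
    · intro h i hi
      exact congrFun h ⟨i, by simpa using hi⟩
  have key : ∀ (π : ℕ → T) (k : ℕ),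
      μ (Cyl π k) = if π 0 = s then ∏ i ∈ Finset.range k, P (π i) (π (i + 1)) else 0 := ?_
  · exact ⟨μ, measure_univ, key⟩
  intro π k
  induction k with
  | zero =>
    have h0 : μ.map (Preorder.frestrictLe (π := fun _ => T) 0) =
        (Measure.dirac s).map (MeasurableEquiv.piUnique (fun _ : Finset.Iic 0 => T)).symm := by
      simp only [μ, Kernel.trajMeasure]
      rw [Measure.map_comp _ _ (Preorder.measurable_frestrictLe 0), Kernel.traj_map_frestrictLe,
        Kernel.partialTraj_self, Measure.id_comp]
    rw [hcyl, ← Measure.map_apply (by fun_prop) (measurableSet_singleton _), h0,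
      Measure.map_apply (by fun_prop) (measurableSet_singleton _)]
    rw [Measure.dirac_apply]
    simp only [Finset.range_zero, Finset.prod_empty, Set.indicator, Set.mem_preimage,
      Set.mem_singleton_iff, Pi.one_apply]
    congr 1
    apply propext
    constructor
    · intro h
      have := congrFun h ⟨0, by simp⟩
      exact this.symm
    · intro h
      funext i
      have : (i : ℕ) = 0 := Nat.le_zero.1 (Finset.mem_Iic.1 i.2)
      rw [this]; exact h.symm
  | succ k ih =>
    have hm := Kernel.map_frestrictLe_trajMeasure_compProd_eq_map_trajMeasure
      (X := fun _ => T) (μ₀ := Measure.dirac s) (κ := κ) (a := k)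
    have hset : Cyl π (k+1) = (fun x : ℕ → T => (Preorder.frestrictLe (π := fun _ => T) k x, x (k + 1)))
        ⁻¹' ({fun i : Finset.Iic k => π i} ×ˢ {π (k+1)}) := by
      ext ω
      have := Set.ext_iff.1 (hcyl π k) ω
      simp only [Cyl, Set.mem_ofPred_eq, Set.mem_preimage, Set.mem_singleton_iff, Set.mem_prod] at this ⊢
      rw [← this]
      constructor
      · intro h; exact ⟨fun i hi => h i (by omega), h _ le_rfl⟩
      · rintro ⟨h1, h2⟩ i hi
        rcases Nat.lt_or_ge i (k+1) with h | h
        · exact h1 i (by omega)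
        · have : i = k+1 := by omega
          rw [this]; exact h2
    rw [hset, ← Measure.map_apply (by fun_prop) (MeasurableSet.prod (measurableSet_singleton _) (measurableSet_singleton _))]
    change Measure.map _ (Kernel.trajMeasure (X := fun _ => T) (Measure.dirac s) κ) _ = _
    rw [← hm, Measure.compProd_apply_prod (measurableSet_singleton _) (measurableSet_singleton _)]
    rw [Measure.restrict_singleton, lintegral_smul_measure, lintegral_dirac, hκ]
    rw [Measure.map_apply (by fun_prop) (measurableSet_singleton _), ← hcyl]
    change μ _ • _ = _
    rw [ih, Finset.prod_range_succ]
    split_ifs <;> simp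

end PathMeasure

section PathMeasure2

noncomputable def evE {T : Type} (P : T → T → ℝ≥0∞) : ℕ → (T → ℝ≥0∞) → T → ℝ≥0∞
  | 0, f, x => f x
  | n+1, f, x => ∑' y, P x y * evE P n f y

variable {T : Type} [Countable T] [MeasurableSpace T] [DiscreteMeasurableSpace T]

theorem measurableSet_Cyl (π : ℕ → T) (k : ℕ) : MeasurableSet (Cyl π k) := by
  have : Cyl π k = ⋂ i : Fin (k+1), (fun ω : ℕ → T => ω i) ⁻¹' {π i} := by
    ext ω
    simp only [Cyl, Set.mem_ofPred_eq, Set.mem_iInter, Set.mem_preimage, Set.mem_singleton_iff]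
    constructor
    · intro h i; exact h i (by omega)
    · intro h i hi; exact h ⟨i, by omega⟩
  rw [this]
  exact MeasurableSet.iInter fun i => (measurable_pi_apply (i : ℕ)) (MeasurableSet.of_discrete)

theorem markov_step (P : T → T → ℝ≥0∞) (s : T) (μ : Measure (ℕ → T))
    (hμ : ∀ (π : ℕ → T) (k : ℕ),
      μ (Cyl π k) = if π 0 = s then ∏ i ∈ Finset.range k, P (π i) (π (i + 1)) else 0)
    (t : ℕ) (x y : T) :
    μ {ω | ω t = x ∧ ω (t+1) = y} = μ {ω | ω t = x} * P x y := by
  let J := {c : Fin (t+1) → T // c (Fin.last t) = x}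
  let p : J → ℕ → T := fun c i => if h : i < t+1 then c.1 ⟨i, h⟩ else y
  have hp : ∀ (c : J) i (h : i < t+1), p c i = c.1 ⟨i, h⟩ := fun c i h => dif_pos h
  have hpt : ∀ c : J, p c t = x := fun c => by rw [hp c t (by omega)]; exact c.2
  have hpt1 : ∀ c : J, p c (t+1) = y := fun c => by simp [p]
  have e1 : {ω : ℕ → T | ω t = x ∧ ω (t+1) = y} = ⋃ c : J, Cyl (p c) (t+1) := by
    ext ω
    simp only [Set.mem_ofPred_eq, Set.mem_iUnion, Cyl]
    constructor
    · rintro ⟨h1, h2⟩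
      refine ⟨⟨fun i => ω i, h1⟩, fun i hi => ?_⟩
      rcases Nat.lt_or_ge i (t+1) with h | h
      · rw [hp _ _ h]
      · have : i = t+1 := by omega
        rw [this, hpt1, h2]
    · rintro ⟨c, hc⟩
      exact ⟨by rw [hc t (by omega), hpt], by rw [hc _ le_rfl, hpt1]⟩
  have e2 : {ω : ℕ → T | ω t = x} = ⋃ c : J, Cyl (p c) t := by
    ext ω
    simp only [Set.mem_ofPred_eq, Set.mem_iUnion, Cyl]
    constructor
    · intro h1
      refine ⟨⟨fun i => ω i, h1⟩, fun i hi => ?_⟩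
      rw [hp _ _ (by omega)]
    · rintro ⟨c, hc⟩
      rw [hc t (by omega), hpt]
  have dj : ∀ k, t ≤ k → Pairwise (Function.onFun Disjoint fun c : J => Cyl (p c) k) := by
    intro k hk c d hcd
    rw [Function.onFun, Set.disjoint_left]
    intro ω h1 h2
    simp only [Cyl, Set.mem_ofPred_eq] at h1 h2
    apply hcd
    apply Subtype.ext
    funext i
    rw [← Fin.eta i i.2, ← hp c i i.2, ← hp d i i.2, ← h1 i (by omega), ← h2 i (by omega)]
  rw [e1, e2, measure_iUnion (dj _ (by omega)) (fun c => measurableSet_Cyl _ _),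
    measure_iUnion (dj _ le_rfl) (fun c => measurableSet_Cyl _ _), ← ENNReal.tsum_mul_right]
  congr 1
  funext c
  rw [hμ, hμ, Finset.prod_range_succ, hpt, hpt1]
  split_ifs <;> simp

theorem measure_eval_mem (μ : Measure (ℕ → T)) (t : ℕ) (B : Set (ℕ → T)) (hB : MeasurableSet B) :
    μ B = ∑' x, μ {ω | ω t = x ∧ ω ∈ B} := by
  have : B = ⋃ x, {ω : ℕ → T | ω t = x ∧ ω ∈ B} := by
    ext ω; simp
  conv_lhs => rw [this]
  rw [measure_iUnion]
  · intro x y hxy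
    rw [Function.onFun, Set.disjoint_left]
    intro ω h1 h2
    exact hxy (h1.1.symm.trans h2.1)
  · intro x
    exact ((measurable_pi_apply t) (MeasurableSet.of_discrete (s := {x}))).inter hB

theorem measurableSet_eval (t : ℕ) (G : Set T) : MeasurableSet {ω : ℕ → T | ω t ∈ G} :=
  (measurable_pi_apply t) (MeasurableSet.of_discrete (s := G))

theorem evE_eq (P : T → T → ℝ≥0∞) (s : T) (μ : Measure (ℕ → T))
    (hμ : ∀ (π : ℕ → T) (k : ℕ),
      μ (Cyl π k) = if π 0 = s then ∏ i ∈ Finset.range k, P (π i) (π (i + 1)) else 0)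
    (f : T → ℝ≥0∞) (t : ℕ) : ∀ n,
    ∑' x, μ {ω | ω t = x} * evE P n f x = evE P (t+n) f s := by
  induction t with
  | zero =>
    intro n
    have h0 : ∀ x, μ {ω : ℕ → T | ω 0 = x} = if x = s then 1 else 0 := by
      intro x
      have := hμ (fun _ => x) 0
      simp only [Finset.range_zero, Finset.prod_empty] at this
      rw [← this]; congr 1; ext ω; simp [Cyl]
    rw [tsum_eq_single s]
    · rw [h0]; simp
    · intro x hx; rw [h0]; simp [hx]
  | succ t ih =>
    intro n
    rw [show t + 1 + n = t + (n+1) by omega, ← ih (n+1)]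
    have h1 : ∀ y, μ {ω : ℕ → T | ω (t+1) = y} = ∑' x, μ {ω | ω t = x} * P x y := by
      intro y
      rw [measure_eval_mem μ t {ω : ℕ → T | ω (t+1) = y} (measurableSet_eval (t+1) {y})]
      congr 1; funext x
      rw [← markov_step P s μ hμ]
      rfl
    simp_rw [h1, evE, ← ENNReal.tsum_mul_right, ← ENNReal.tsum_mul_left]
    rw [ENNReal.tsum_comm]
    simp_rw [mul_assoc]

theorem measure_reach (P : T → T → ℝ≥0∞) (s : T) (μ : Measure (ℕ → T))
    (hμ : ∀ (π : ℕ → T) (k : ℕ),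
      μ (Cyl π k) = if π 0 = s then ∏ i ∈ Finset.range k, P (π i) (π (i + 1)) else 0)
    (G : Set T) (hG : ∀ x ∈ G, ∀ y, y ∉ G → P x y = 0) :
    μ {ω | ∃ t, ω t ∈ G} = ⨆ t, evE P t (fun x => if x ∈ G then 1 else 0) s := by
  have h1 : ∀ t, μ {ω | ω t ∈ G} = evE P t (fun x => if x ∈ G then 1 else 0) s := by
    intro t
    rw [← add_zero t, ← evE_eq P s μ hμ _ t 0, add_zero, measure_eval_mem μ t _ (measurableSet_eval t G)]
    congr 1; funext x
    simp only [evE]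
    split_ifs with hx
    · rw [mul_one]; congr 1; ext ω; simp only [Set.mem_ofPred_eq]
      constructor
      · exact fun h => h.1
      · exact fun h => ⟨h, h ▸ hx⟩
    · rw [mul_zero]
      have : {ω : ℕ → T | ω t = x ∧ ω ∈ {ω : ℕ → T | ω t ∈ G}} = ∅ := by
        ext ω; simp only [Set.mem_ofPred_eq, Set.mem_empty_iff_false, iff_false]
        rintro ⟨h, h'⟩; exact hx (h ▸ h')
      rw [this, measure_empty]
  have h2 : ∀ t, μ {ω | ω t ∈ G ∧ ω (t+1) ∉ G} = 0 := by
    intro t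
    have : {ω : ℕ → T | ω t ∈ G ∧ ω (t+1) ∉ G} ⊆
        ⋃ z : {z : T × T // z.1 ∈ G ∧ z.2 ∉ G}, {ω | ω t = z.1.1 ∧ ω (t+1) = z.1.2} := by
      intro ω hω
      exact Set.mem_iUnion.2 ⟨⟨(ω t, ω (t+1)), hω⟩, rfl, rfl⟩
    refine measure_mono_null this (measure_iUnion_null fun z => ?_)
    rw [markov_step P s μ hμ, hG _ z.2.1 _ z.2.2, mul_zero]
  have h3 : {ω : ℕ → T | ∃ t, ω t ∈ G} = ⋃ t, {ω : ℕ → T | ∃ i ≤ t, ω i ∈ G} := by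
    ext ω; simp only [Set.mem_ofPred_eq, Set.mem_iUnion]
    exact ⟨fun ⟨t, h⟩ => ⟨t, t, le_rfl, h⟩, fun ⟨_, i, _, h⟩ => ⟨i, h⟩⟩
  have hmono : Monotone fun t => {ω : ℕ → T | ∃ i ≤ t, ω i ∈ G} := by
    intro a b hab ω hω
    obtain ⟨i, hi, h⟩ := hω
    exact ⟨i, hi.trans hab, h⟩
  rw [h3, hmono.measure_iUnion]
  congr 1; funext t
  rw [← h1 t]
  apply le_antisymm
  · have : {ω : ℕ → T | ∃ i ≤ t, ω i ∈ G} ⊆ {ω | ω t ∈ G} ∪ ⋃ j, {ω | ω j ∈ G ∧ ω (j+1) ∉ G} := by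
      intro ω hω
      obtain ⟨i, hi, h⟩ := hω
      by_cases hc : ∃ j, ω j ∈ G ∧ ω (j+1) ∉ G
      · right; exact Set.mem_iUnion.2 hc
      · left
        push Not at hc
        exact Nat.le_induction h (fun n _ hn => hc n hn) t hi
    refine (measure_mono this).trans ((measure_union_le _ _).trans ?_)
    rw [measure_iUnion_null h2, add_zero]
  · apply measure_mono
    intro ω hω
    exact ⟨t, le_rfl, hω⟩

end PathMeasure2

section Basic
open Filter Topology

theorem MDP.P_le_one (M : MDP S Act) (s : S) (a : Act) (s' : S) : M.P s a s' ≤ 1 := by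
  have h : M.P s a s' ≤ ∑ t, M.P s a t :=
    Finset.single_le_sum (f := fun t => M.P s a t) (fun _ _ => zero_le) (Finset.mem_univ s')
  rcases M.sum_mem s a with h0 | h0 <;> rw [h0] at h
  · exact h.trans zero_le_one
  · exact h

theorem Strategy.out_le_one {M : MDP S Act} (σ : Strategy M) (q : σ.Q) (s : S) (a : Act) :
    σ.out q s a ≤ 1 := by
  rw [← σ.out_sum q s]
  exact Finset.single_le_sum (f := fun t => σ.out q s t) (fun _ _ => zero_le) (Finset.mem_univ a)

noncomputable def pr (M : MDP S Act) (s : S) (a : Act) (s' : S) : ℝ := (M.P s a s').toReal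

noncomputable def kr (M : MDP S Act) (σ : Strategy M) (x : S × σ.Q) (s' : S) : ℝ :=
  ∑ a, (σ.out x.2 x.1 a).toReal * pr M x.1 a s'

noncomputable def ev (M : MDP S Act) (σ : Strategy M) : ℕ → (S × σ.Q → ℝ) → S × σ.Q → ℝ
  | 0, f, x => f x
  | n+1, f, x => ∑ s', kr M σ x s' * ev M σ n f (s', σ.next x.2 x.1)

variable (M : MDP S Act) (σ : Strategy M)

theorem pr_nonneg (s a s') : 0 ≤ pr M s a s' := ENNReal.toReal_nonneg

theorem pr_sum (s a) (h : (∑ s', M.P s a s') = 1) : ∑ s', pr M s a s' = 1 := by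
  unfold pr
  rw [← ENNReal.toReal_sum, h, ENNReal.toReal_one]
  intro s' _; exact ne_top_of_le_ne_top ENNReal.one_ne_top (M.P_le_one s a s')

theorem out_sum_real (q : σ.Q) (s : S) : ∑ a, (σ.out q s a).toReal = 1 := by
  rw [← ENNReal.toReal_sum, σ.out_sum, ENNReal.toReal_one]
  intro s' _; exact ne_top_of_le_ne_top ENNReal.one_ne_top (σ.out_le_one q s s')

theorem kr_nonneg (x : S × σ.Q) (s' : S) : 0 ≤ kr M σ x s' :=
  Finset.sum_nonneg fun _ _ => mul_nonneg ENNReal.toReal_nonneg ENNReal.toReal_nonneg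

theorem kr_sum (x : S × σ.Q) : ∑ s', kr M σ x s' = 1 := by
  unfold kr
  rw [Finset.sum_comm]
  rw [← out_sum_real M σ x.2 x.1]
  refine Finset.sum_congr rfl fun a _ => ?_
  rw [← Finset.mul_sum]
  by_cases h : σ.out x.2 x.1 a = 0
  · simp [h]
  · rw [pr_sum M _ _ (σ.out_enabled _ _ _ h), mul_one]

theorem ofReal_kr (x : S × σ.Q) (s' : S) :
    ENNReal.ofReal (kr M σ x s') = ∑ a, σ.out x.2 x.1 a * M.P x.1 a s' := by
  unfold kr
  rw [ENNReal.ofReal_sum_of_nonneg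
    (fun _ _ => mul_nonneg ENNReal.toReal_nonneg (pr_nonneg M _ _ _))]
  refine Finset.sum_congr rfl fun a _ => ?_
  rw [ENNReal.ofReal_mul ENNReal.toReal_nonneg, pr, ENNReal.ofReal_toReal, ENNReal.ofReal_toReal]
  · exact ne_top_of_le_ne_top ENNReal.one_ne_top (M.P_le_one _ _ _)
  · exact ne_top_of_le_ne_top ENNReal.one_ne_top (σ.out_le_one _ _ _)

theorem step_eq (x y : S × σ.Q) :
    M.step σ x y = if σ.next x.2 x.1 = y.2 then ENNReal.ofReal (kr M σ x y.1) else 0 := by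
  rw [ofReal_kr]; rfl

theorem step_pos_iff (x y : S × σ.Q) :
    0 < M.step σ x y ↔ σ.next x.2 x.1 = y.2 ∧ 0 < kr M σ x y.1 := by
  rw [step_eq]
  split_ifs with h
  · simp [h]
  · simp [h]

theorem kr_pos_of {x : S × σ.Q} {a : Act} {s' : S} (ha : σ.out x.2 x.1 a ≠ 0)
    (hs : 0 < pr M x.1 a s') : 0 < kr M σ x s' := by
  refine Finset.sum_pos' (fun _ _ => mul_nonneg ENNReal.toReal_nonneg ENNReal.toReal_nonneg)
    ⟨a, Finset.mem_univ _, mul_pos ?_ hs⟩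
  exact ENNReal.toReal_pos ha (ne_top_of_le_ne_top ENNReal.one_ne_top (σ.out_le_one _ _ _))

theorem ev_mono_on (R : Set (S × σ.Q))
    (hR : ∀ x ∈ R, ∀ s', 0 < kr M σ x s' → (s', σ.next x.2 x.1) ∈ R)
    (f g : S × σ.Q → ℝ) (hfg : ∀ x ∈ R, f x ≤ g x) (n : ℕ) :
    ∀ x ∈ R, ev M σ n f x ≤ ev M σ n g x := by
  induction n with
  | zero => exact hfg
  | succ n ih =>
    intro x hx
    refine Finset.sum_le_sum fun s' _ => ?_
    rcases (kr_nonneg M σ x s').eq_or_lt with h | h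
    · rw [← h]; simp
    · exact mul_le_mul_of_nonneg_left (ih _ (hR x hx s' h)) h.le

theorem ev_congr_on (R : Set (S × σ.Q))
    (hR : ∀ x ∈ R, ∀ s', 0 < kr M σ x s' → (s', σ.next x.2 x.1) ∈ R)
    (f g : S × σ.Q → ℝ) (hfg : ∀ x ∈ R, f x = g x) (n : ℕ) :
    ∀ x ∈ R, ev M σ n f x = ev M σ n g x := fun x hx =>
  le_antisymm (ev_mono_on M σ R hR f g (fun y hy => (hfg y hy).le) n x hx)
    (ev_mono_on M σ R hR g f (fun y hy => (hfg y hy).ge) n x hx)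

theorem ev_mono (f g : S × σ.Q → ℝ) (hfg : ∀ x, f x ≤ g x) (n : ℕ) (x) :
    ev M σ n f x ≤ ev M σ n g x :=
  ev_mono_on M σ Set.univ (fun _ _ _ _ => trivial) f g (fun x _ => hfg x) n x trivial

theorem ev_const (c : ℝ) (n : ℕ) : ∀ x, ev M σ n (fun _ => c) x = c := by
  induction n with
  | zero => intro x; rfl
  | succ n ih =>
    intro x
    simp only [ev, ih]
    rw [← Finset.sum_mul, kr_sum, one_mul]

theorem ev_nonneg (f : S × σ.Q → ℝ) (hf : ∀ x, 0 ≤ f x) (n : ℕ) (x) : 0 ≤ ev M σ n f x := by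
  rw [← ev_const M σ 0 n x]; exact ev_mono M σ _ _ hf n x

theorem ev_add (f g : S × σ.Q → ℝ) (n : ℕ) : ∀ x,
    ev M σ n (fun x => f x + g x) x = ev M σ n f x + ev M σ n g x := by
  induction n with
  | zero => intro x; rfl
  | succ n ih =>
    intro x
    simp only [ev, ih, mul_add, Finset.sum_add_distrib]

theorem ev_smul (c : ℝ) (f : S × σ.Q → ℝ) (n : ℕ) : ∀ x,
    ev M σ n (fun x => c * f x) x = c * ev M σ n f x := by
  induction n with
  | zero => intro x; rfl
  | succ n ih =>
    intro x
    simp only [ev, ih, Finset.mul_sum]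
    refine Finset.sum_congr rfl fun _ _ => by ring

theorem ev_sub (f g : S × σ.Q → ℝ) (n : ℕ) (x) :
    ev M σ n (fun x => f x - g x) x = ev M σ n f x - ev M σ n g x := by
  have := ev_add M σ f (fun x => (-1) * g x) n x
  rw [ev_smul] at this
  simp only [sub_eq_add_neg, neg_one_mul] at this ⊢
  exact this

theorem ev_sum {ι : Type} (I : Finset ι) (f : ι → S × σ.Q → ℝ) (n : ℕ) (x) :
    ev M σ n (fun x => ∑ i ∈ I, f i x) x = ∑ i ∈ I, ev M σ n (f i) x := by
  induction I using Finset.induction_on with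
  | empty => simp [ev_const]
  | insert a s ha ih => simp only [Finset.sum_insert ha, ev_add, ih]

theorem ev_succ_eq (f : S × σ.Q → ℝ) (n : ℕ) : ∀ x,
    ev M σ (n+1) f x = ev M σ n (ev M σ 1 f) x := by
  induction n with
  | zero => intro x; rfl
  | succ n ih =>
    intro x
    rw [ev]
    simp only [ih]
    rfl

theorem ev_add_time (f : S × σ.Q → ℝ) (m n : ℕ) : ∀ x,
    ev M σ (m+n) f x = ev M σ m (ev M σ n f) x := by
  induction m with
  | zero => intro x; rw [zero_add]; rfl
  | succ m ih =>
    intro x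
    rw [show m + 1 + n = (m+n)+1 by omega, ev, ev]
    simp only [ih]

theorem ev_tendsto (f : ℕ → S × σ.Q → ℝ) (g : S × σ.Q → ℝ)
    (h : ∀ x, Tendsto (fun k => f k x) atTop (𝓝 (g x))) (n : ℕ) : ∀ x,
    Tendsto (fun k => ev M σ n (f k) x) atTop (𝓝 (ev M σ n g x)) := by
  induction n with
  | zero => exact h
  | succ n ih =>
    intro x
    exact tendsto_finsetSum _ fun s' _ => (ih _).const_mul _

noncomputable def ind (G : Set S) (s : S) : ℝ := if s ∈ G then 1 else 0

theorem ind_nonneg (G : Set S) (s : S) : 0 ≤ ind G s := by unfold ind; split_ifs <;> norm_num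
theorem ind_le_one (G : Set S) (s : S) : ind G s ≤ 1 := by unfold ind; split_ifs <;> norm_num

noncomputable def rn (G : Set S) (n : ℕ) (x : S × σ.Q) : ℝ := ev M σ n (fun y => ind G y.1) x

noncomputable def val (G : Set S) (x : S × σ.Q) : ℝ := ⨆ n, rn M σ G n x

theorem kr_sink (x : S × σ.Q) (hx : M.IsSink x.1) (s' : S) :
    kr M σ x s' = if s' = x.1 then 1 else 0 := by
  have h1 : kr M σ x x.1 = 1 := by
    unfold kr
    rw [← out_sum_real M σ x.2 x.1]
    refine Finset.sum_congr rfl fun a _ => ?_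
    by_cases h : σ.out x.2 x.1 a = 0
    · simp [h]
    · rw [pr, hx a (σ.out_enabled _ _ _ h)]; simp
  split_ifs with h
  · rw [h, h1]
  · have h2 := kr_sum M σ x
    rw [← Finset.add_sum_erase _ _ (Finset.mem_univ x.1), h1] at h2
    have h3 : ∑ t ∈ Finset.univ.erase x.1, kr M σ x t = 0 := by linarith
    rw [Finset.sum_eq_zero_iff_of_nonneg (fun _ _ => kr_nonneg M σ x _)] at h3
    exact h3 s' (by simp [h])

theorem ev_sink (f : S × σ.Q → ℝ) (c : ℝ) (n : ℕ) : ∀ (x : S × σ.Q), M.IsSink x.1 →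
    (∀ q, f (x.1, q) = c) → ev M σ n f x = c := by
  induction n with
  | zero => intro x _ h; exact h x.2
  | succ n ih =>
    intro x hx h
    rw [ev]
    simp only [kr_sink M σ x hx, ite_mul, one_mul, zero_mul, Finset.sum_ite_eq', Finset.mem_univ, if_true]
    exact ih (x.1, _) hx h

theorem rn_nonneg (G : Set S) (n x) : 0 ≤ rn M σ G n x :=
  ev_nonneg M σ _ (fun _ => ind_nonneg _ _) n x

theorem rn_le_one (G : Set S) (n x) : rn M σ G n x ≤ 1 := by
  rw [← ev_const M σ 1 n x]; exact ev_mono M σ _ _ (fun _ => ind_le_one _ _) n x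

theorem rn_mono (G : Set S) (hG : ∀ s ∈ G, M.IsSink s) (x) : Monotone fun n => rn M σ G n x := by
  refine monotone_nat_of_le_succ fun n => ?_
  unfold rn
  rw [ev_succ_eq]
  refine ev_mono M σ _ _ (fun y => ?_) n x
  by_cases hy : y.1 ∈ G
  · rw [ev_sink M σ _ 1 1 y (hG _ hy) (fun q => by simp [ind, hy])]
    exact ind_le_one _ _
  · simp only [ind, hy, if_false]
    exact ev_nonneg M σ _ (fun _ => ind_nonneg _ _) 1 y

theorem rn_bdd (G : Set S) (x) : BddAbove (Set.range fun n => rn M σ G n x) :=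
  ⟨1, by rintro _ ⟨n, rfl⟩; exact rn_le_one M σ G n x⟩

theorem rn_le_val (G : Set S) (n x) : rn M σ G n x ≤ val M σ G x := le_ciSup (rn_bdd M σ G x) n

theorem val_nonneg (G : Set S) (x) : 0 ≤ val M σ G x :=
  (rn_nonneg M σ G 0 x).trans (rn_le_val M σ G 0 x)

theorem val_le_one (G : Set S) (x) : val M σ G x ≤ 1 := ciSup_le fun n => rn_le_one M σ G n x

theorem rn_tendsto (G : Set S) (hG : ∀ s ∈ G, M.IsSink s) (x) :
    Tendsto (fun n => rn M σ G n x) atTop (𝓝 (val M σ G x)) :=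
  tendsto_atTop_ciSup (rn_mono M σ G hG x) (rn_bdd M σ G x)

theorem val_ev (G : Set S) (hG : ∀ s ∈ G, M.IsSink s) (n : ℕ) (x) :
    ev M σ n (val M σ G) x = val M σ G x := by
  have h1 := ev_tendsto M σ (fun k => rn M σ G k) (val M σ G) (rn_tendsto M σ G hG) n x
  refine tendsto_nhds_unique h1 ?_
  have h2 := (rn_tendsto M σ G hG x).comp (tendsto_add_atTop_nat n)
  refine h2.congr fun k => ?_
  simp only [Function.comp, rn]
  rw [add_comm, ev_add_time]
  rfl

theorem val_sink (G : Set S) (x : S × σ.Q) (hx : M.IsSink x.1) : val M σ G x = ind G x.1 := by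
  unfold val rn
  rw [show (fun n => ev M σ n (fun y => ind G y.1) x) = fun _ => ind G x.1 from
    funext fun n => ev_sink M σ _ _ n x hx (fun q => rfl)]
  exact ciSup_const

theorem val_mono (G H : Set S) (h : G ⊆ H) (x) : val M σ G x ≤ val M σ H x := by
  refine ciSup_mono (rn_bdd M σ H x) fun n => ev_mono M σ _ _ (fun y => ?_) n x
  unfold ind
  by_cases hy : y.1 ∈ G
  · simp [hy, h hy]
  · simp only [hy, if_false]; split_ifs <;> norm_num

theorem evE_step (f : S × σ.Q → ℝ) (hf : ∀ x, 0 ≤ f x) (n : ℕ) : ∀ x,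
    evE (M.step σ) n (fun x => ENNReal.ofReal (f x)) x = ENNReal.ofReal (ev M σ n f x) := by
  induction n with
  | zero => intro x; rfl
  | succ n ih =>
    intro x
    rw [evE, ev, ENNReal.ofReal_sum_of_nonneg
      (fun s' _ => mul_nonneg (kr_nonneg M σ x s') (ev_nonneg M σ f hf n _))]
    simp_rw [ih, step_eq]
    rw [ENNReal.tsum_prod', tsum_fintype]
    refine Finset.sum_congr rfl fun s' _ => ?_
    rw [tsum_eq_single (σ.next x.2 x.1)]
    · rw [if_pos rfl, ENNReal.ofReal_mul (kr_nonneg M σ x s')]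
    · intro q hq; rw [if_neg (fun h => hq h.symm), zero_mul]

theorem step_tsum (x : S × σ.Q) : ∑' y, M.step σ x y = 1 := by
  have h := evE_step M σ (fun _ => 1) (fun _ => zero_le_one) 1 x
  rw [ev_const] at h
  simpa [evE] using h

theorem Pr_eq (s : S) (G : Set S) (hG : ∀ s ∈ G, M.IsSink s) :
    M.Pr σ s (ReachObj G) = ENNReal.ofReal (val M σ G (s, σ.init)) := by
  have := σ.countable
  let mT : MeasurableSpace (S × σ.Q) := ⊤
  have : DiscreteMeasurableSpace (S × σ.Q) := ⟨fun _ => trivial⟩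
  have hex := exists_pathMeasure (M.step σ) (step_tsum M σ) (s, σ.init)
  have hspec : IsPathMeasure (M.step σ) (s, σ.init) (pathMeasure (M.step σ) (s, σ.init)) := by
    unfold pathMeasure; rw [dif_pos hex]; exact hex.choose_spec
  have key := measure_reach (M.step σ) (s, σ.init) (pathMeasure (M.step σ) (s, σ.init)) hspec.2
    {x | x.1 ∈ G} ?_
  · have e : (fun x : S × σ.Q => if x ∈ {x : S × σ.Q | x.1 ∈ G} then (1 : ℝ≥0∞) else 0) =
        fun x => ENNReal.ofReal (ind G x.1) := by
      funext x; unfold ind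
      by_cases hx : x.1 ∈ G <;> simp [hx]
    rw [e] at key
    refine Eq.trans key ?_
    have hb := rn_tendsto M σ G hG (s, σ.init)
    have h1 := ENNReal.tendsto_ofReal hb
    refine tendsto_nhds_unique ?_ h1
    refine (tendsto_atTop_iSup ?_).congr fun n => evE_step M σ _ (fun _ => ind_nonneg _ _) n _
    intro a b hab
    simp only [evE_step M σ (fun x => ind G x.1) (fun _ => ind_nonneg _ _)]
    exact ENNReal.ofReal_le_ofReal (rn_mono M σ G hG _ hab)
  · intro x hx y hy
    simp only [Set.mem_ofPred_eq] at hx hy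
    rw [step_eq, kr_sink M σ x (hG _ hx)]
    rw [if_neg (fun h : y.1 = x.1 => hy (h ▸ hx))]
    simp

end Basic

section Par

/-- Bad priority sequence. -/
def BadSeq (c : ℕ → ℕ) : Prop :=
  ∃ j, Odd j ∧ (∃ N, ∀ i ≥ N, c i ≤ j) ∧ (∀ N, ∃ i ≥ N, c i = j)

theorem parity_max (φ : S → ℕ) (π : ℕ → S) :
    (∃ N, ∀ i ≥ N, φ (π i) ≤ sSup (φ '' InfOft π)) ∧
      (∀ N, ∃ i ≥ N, φ (π i) = sSup (φ '' InfOft π)) := by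
  have h1 : ∃ N, ∀ i ≥ N, π i ∈ InfOft π := by
    have h : ∀ s : S, ∃ N, s ∉ InfOft π → ∀ i ≥ N, π i ≠ s := by
      intro s
      by_cases hs : s ∈ InfOft π
      · exact ⟨0, fun h => absurd hs h⟩
      · have hs' := hs
        simp only [InfOft, Set.mem_ofPred_eq, not_forall, not_exists, not_and] at hs'
        obtain ⟨N, hN⟩ := hs'
        exact ⟨N, fun _ i hi => hN i hi⟩
    choose N hN using h
    refine ⟨Finset.univ.sup N, fun i hi => ?_⟩
    by_contra hc
    exact hN (π i) hc i ((Finset.le_sup (f := N) (Finset.mem_univ (π i))).trans hi) rfl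
  obtain ⟨N, hN⟩ := h1
  have hb : BddAbove (φ '' InfOft π) := (Set.toFinite _).bddAbove
  have hne : (φ '' InfOft π).Nonempty := ⟨_, _, hN N le_rfl, rfl⟩
  refine ⟨⟨N, fun i hi => le_csSup hb ⟨_, hN i hi, rfl⟩⟩, fun N => ?_⟩
  obtain ⟨s, hs, hs'⟩ := Nat.sSup_mem hne hb
  obtain ⟨i, hi, h⟩ := hs N
  exact ⟨i, hi, by rw [h, hs']⟩

theorem parity_iff (φ : S → ℕ) (π : ℕ → S) :
    π ∈ ParityObj φ ↔ ¬ BadSeq (fun i => φ (π i)) := by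
  obtain ⟨⟨N, hN⟩, hm⟩ := parity_max φ π
  constructor
  · rintro h ⟨j, hj, ⟨N', hN'⟩, hj'⟩
    have : j = sSup (φ '' InfOft π) := by
      refine le_antisymm ?_ ?_
      · obtain ⟨i, hi, e⟩ := hj' N
        exact e ▸ hN i hi
      · obtain ⟨i, hi, e⟩ := hm N'
        exact e ▸ hN' i hi
    rw [this] at hj
    exact (Nat.not_even_iff_odd.mpr hj) h
  · intro h
    by_contra hc
    exact h ⟨_, Nat.not_even_iff_odd.mp hc, ⟨N, hN⟩, hm⟩

variable {T : Type} (E : T → T → Prop) (R : Set T) (c : T → ℕ)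

theorem sig_one (hR : ∀ x ∈ R, ∀ y, E x y → y ∈ R)
    (hpath : ∀ π : ℕ → T, π 0 ∈ R → (∀ i, E (π i) (π (i+1))) → ¬ BadSeq (fun i => c (π i)))
    (j : ℕ) (hj : Odd j) :
    ∃ ρ : T → Ordinal.{0}, ∀ x ∈ R, ∀ y, E x y →
      (c x ≤ j → ρ y ≤ ρ x) ∧ (c x = j → ρ y < ρ x) := by
  let A : T → T → Prop := fun x y => x ∈ R ∧ E x y ∧ c x ≤ j
  let J : T → T → Prop := fun y x => ∃ a b, Relation.ReflTransGen A x a ∧ c a = j ∧ A a b ∧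
    Relation.ReflTransGen A b y
  have hJA : ∀ x x' y, A x x' → J y x' → J y x := by
    rintro x x' y hA ⟨a, b, h1, h2, h3, h4⟩
    exact ⟨a, b, h1.head hA, h2, h3, h4⟩
  have hJA2 : ∀ x x' y, Relation.ReflTransGen A x x' → J y x' → J y x := by
    rintro x x' y hA ⟨a, b, h1, h2, h3, h4⟩
    exact ⟨a, b, hA.trans h1, h2, h3, h4⟩
  have hwf : WellFounded J := by
    refine ⟨fun x0 => ?_⟩
    by_contra hx0
    let N : Set T := {x | ¬ Acc J x}
    have hN1 : ∀ x ∈ N, ∃ y ∈ N, J y x := by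
      intro x hx
      by_contra hc
      push Not at hc
      exact hx ⟨_, fun y hy => by_contra fun h => hc y h hy⟩
    have hNback : ∀ x x', Relation.ReflTransGen A x x' → x' ∈ N → x ∈ N := by
      intro x x' h hx' hx
      obtain ⟨y, hy, hJ⟩ := hN1 x' hx'
      exact hy (hx.inv (hJA2 _ _ _ h hJ))
    let D : ℕ → T → Prop := fun k => Nat.rec (fun x => x ∈ N ∧ c x = j ∧ ∃ b ∈ N, A x b)
      (fun _ ih x => ∃ x', A x x' ∧ ih x') k
    have hD0 : ∀ x, D 0 x ↔ (x ∈ N ∧ c x = j ∧ ∃ b ∈ N, A x b) := fun x => Iff.rfl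
    have hDs : ∀ k x, D (k+1) x ↔ ∃ x', A x x' ∧ D k x' := fun k x => Iff.rfl
    have hDN : ∀ k x, D k x → x ∈ N := by
      intro k
      induction k with
      | zero => intro x h; exact h.1
      | succ k ih =>
        rintro x ⟨x', h1, h2⟩
        exact hNback x x' (Relation.ReflTransGen.single h1) (ih x' h2)
    have hDex : ∀ x ∈ N, ∃ k, D k x := by
      intro x hx
      obtain ⟨y, hy, a, b, h1, h2, h3, h4⟩ := hN1 x hx
      have hb : b ∈ N := hNback b y h4 hy
      have ha : a ∈ N := hNback a b (Relation.ReflTransGen.single h3) hb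
      clear hx
      induction h1 using Relation.ReflTransGen.head_induction_on with
      | refl => exact ⟨0, ha, h2, b, hb, h3⟩
      | head h _ ih => obtain ⟨k, hk⟩ := ih; exact ⟨k+1, _, h, hk⟩
    let d : T → ℕ := fun x => sInf {k | D k x}
    have hd : ∀ x ∈ N, D (d x) x := by
      intro x hx
      exact Nat.sInf_mem (s := {k | D k x}) (hDex x hx)
    have hdle : ∀ x k, D k x → d x ≤ k := by
      intro x k hk
      exact Nat.sInf_le (s := {k | D k x}) hk
    have hstep : ∀ x : N, ∃ x' : N, A x x' ∧ (c x = j ∨ d x' < d x) := by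
      rintro ⟨x, hx⟩
      have h := hd x hx
      cases hk : d x with
      | zero =>
        rw [hk] at h
        obtain ⟨_, h2, b, hb, h3⟩ := h
        exact ⟨⟨b, hb⟩, h3, Or.inl h2⟩
      | succ k =>
        rw [hk] at h
        obtain ⟨x', h1, h2⟩ := h
        exact ⟨⟨x', hDN k x' h2⟩, h1, Or.inr (Nat.lt_succ_of_le (hdle x' k h2))⟩
    choose nx hnx using hstep
    let π : ℕ → N := fun i => nx^[i] ⟨x0, hx0⟩
    have hπ : ∀ i, π (i+1) = nx (π i) := fun i => Function.iterate_succ_apply' nx i _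
    have hA : ∀ i, A (π i) (π (i+1)) := fun i => by rw [hπ]; exact (hnx (π i)).1
    refine hpath (fun i => (π i : T)) (hA 0).1 (fun i => (hA i).2.1)
      ⟨j, hj, ⟨0, fun i _ => (hA i).2.2⟩, ?_⟩
    have : ∀ m N, d (π N) = m → ∃ i ≥ N, c (π i) = j := by
      intro m
      induction m using Nat.strong_induction_on with
      | _ m ih =>
        intro N hN
        rcases (hnx (π N)).2 with h | h
        · exact ⟨N, le_rfl, h⟩
        · rw [← hπ, hN] at h
          obtain ⟨i, hi, h'⟩ := ih _ h (N+1) rfl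
          exact ⟨i, by omega, h'⟩
    exact fun N => this _ N rfl
  have : IsWellFounded T J := ⟨hwf⟩
  refine ⟨IsWellFounded.rank J, fun x hx y hE => ⟨fun hc => ?_, fun hc => ?_⟩⟩
  · rw [IsWellFounded.rank_eq]
    refine Ordinal.iSup_le ?_
    rintro ⟨z, hz⟩
    exact Order.succ_le_of_lt (IsWellFounded.rank_lt_of_rel (hJA x y z ⟨hx, hE, hc⟩ hz))
  · exact IsWellFounded.rank_lt_of_rel ⟨x, y, .refl, hc, ⟨hx, hE, hc.le⟩, .refl⟩

theorem sig_main (hR : ∀ x ∈ R, ∀ y, E x y → y ∈ R)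
    (hpath : ∀ π : ℕ → T, π 0 ∈ R → (∀ i, E (π i) (π (i+1))) → ¬ BadSeq (fun i => c (π i)))
    (K : ℕ) (hK : ∀ x, c x ≤ K) :
    ∃ (O : Type 1) (_ : LinearOrder O) (_ : WellFoundedLT O) (sig : T → O),
      ∀ π : ℕ → T, (∀ i, π i ∈ R) → (∀ i, ∃ y, E (π i) y ∧ sig (π (i+1)) ≤ sig y) →
        ¬ BadSeq (fun i => c (π i)) := by
  choose ρ hρ using fun j : {j : ℕ // Odd j} => sig_one E R c hR hpath j.1 j.2
  let sg : T → Fin (K+1) → Ordinal.{0} := fun x i => if h : Odd i.1 then ρ ⟨i.1, h⟩ x else 0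
  refine ⟨Colex (Fin (K+1) → Ordinal.{0}), inferInstance,
    Pi.Colex.wellFoundedLT (α := fun _ : Fin (K+1) => Ordinal.{0}),
    fun x => toColex (sg x), ?_⟩
  rintro π hπR hπ ⟨j, hj, ⟨N, hN⟩, hinf⟩
  have hjK : j < K + 1 := by
    obtain ⟨i, _, h⟩ := hinf 0
    have := hK (π i)
    have h' : c (π i) = j := h
    omega
  let tr : (Fin (K+1) → Ordinal.{0}) → Fin (K+1) → Ordinal.{0} := fun v i => if i.1 < j then 0 else v i
  have htr : ∀ v w, toColex v ≤ toColex w → toColex (tr v) ≤ toColex (tr w) := by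
    intro v w h
    rcases h.eq_or_lt with h | h
    · rw [toColex_inj.mp h]
    · obtain ⟨i, h1, h2⟩ := h
      by_cases hi : i.1 < j
      · refine le_of_eq ?_
        congr 1
        funext k
        simp only [tr]
        split_ifs with hk
        · rfl
        · exact h1 k (by show i < k; rw [Fin.lt_def]; omega)
      · refine le_of_lt ⟨i, fun k hk => ?_, ?_⟩
        · have hk' : i < k := hk
          rw [Fin.lt_def] at hk'
          show tr v k = tr w k
          simp only [tr]
          rw [if_neg (by omega), if_neg (by omega)]
          exact h1 k hk
        · show tr v i < tr w i
          simp only [tr]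
          rw [if_neg hi, if_neg hi]
          exact h2
  let g : ℕ → Colex (Fin (K+1) → Ordinal.{0}) := fun i => toColex (tr (sg (π i)))
  have hle : ∀ i ≥ N, g (i+1) ≤ g i ∧ (c (π i) = j → g (i+1) < g i) := by
    intro i hi
    obtain ⟨y, hy, hs⟩ := hπ i
    have h1 : g (i+1) ≤ toColex (tr (sg y)) := htr _ _ hs
    have hp : tr (sg y) ≤ tr (sg (π i)) := by
      intro k
      simp only [tr, sg]
      split_ifs with hk ho
      · exact le_rfl
      · exact (hρ ⟨k.1, ho⟩ _ (hπR i) y hy).1 ((hN i hi).trans (by show j ≤ k.1; omega))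
      · exact le_rfl
    have h2 : toColex (tr (sg y)) ≤ g i := Pi.toColex_monotone hp
    refine ⟨h1.trans h2, fun hc => h1.trans_lt (lt_of_le_of_ne h2 fun he => ?_)⟩
    have he' := congrFun (toColex_inj.mp he) ⟨j, hjK⟩
    simp only [tr, sg] at he'
    rw [if_neg (by simp), dif_pos hj, if_neg (by simp), dif_pos hj] at he'
    exact absurd he' ((hρ ⟨j, hj⟩ _ (hπR i) y hy).2 hc).ne
  have hanti : ∀ i ≥ N, ∀ k ≥ i, g k ≤ g i := by
    intro i hi k hk
    induction k, hk using Nat.le_induction with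
    | base => exact le_rfl
    | succ k hk ih => exact (hle k (by omega)).1.trans ih
  have key : ∀ o : Colex (Fin (K+1) → Ordinal.{0}), ∀ i ≥ N, g i = o → False := by
    intro o
    have : WellFoundedLT (Colex (Fin (K+1) → Ordinal.{0})) :=
      Pi.Colex.wellFoundedLT (α := fun _ : Fin (K+1) => Ordinal.{0})
    induction o using WellFoundedLT.induction with
    | ind o ih =>
      intro i hi he
      obtain ⟨k, hk, hck⟩ := hinf i
      have h1 := (hle k (by omega)).2 hck
      have h2 := hanti i hi k hk
      exact ih (g (k+1)) (by rw [← he]; exact h1.trans_le h2) (k+1) (by omega) rfl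
  exact key _ N le_rfl rfl

theorem good_reach (x0 : T)
    (hpath : ∀ π : ℕ → T, π 0 = x0 → (∀ i, E (π i) (π (i+1))) → ¬ BadSeq (fun i => c (π i)))
    (π : ℕ → T) (h0 : Relation.ReflTransGen E x0 (π 0)) (hπ : ∀ i, E (π i) (π (i+1))) :
    ¬ BadSeq (fun i => c (π i)) := by
  have : ∀ x, Relation.ReflTransGen E x0 x → ∀ π : ℕ → T, π 0 = x → (∀ i, E (π i) (π (i+1))) →
      ¬ BadSeq (fun i => c (π i)) := by
    intro x hx
    induction hx with
    | refl => exact hpath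
    | @tail a b _ hE ih =>
      intro π h0 hπ hbad
      refine ih (fun i => Nat.casesOn i a π) rfl ?_ ?_
      · intro i
        cases i with
        | zero => show E a (π 0); rw [h0]; exact hE
        | succ i => exact hπ i
      · obtain ⟨j, hj, ⟨N, hN⟩, hinf⟩ := hbad
        refine ⟨j, hj, ⟨N+1, fun i hi => ?_⟩, fun N' => ?_⟩
        · cases i with
          | zero => omega
          | succ i => exact hN i (by omega)
        · obtain ⟨i, hi, h⟩ := hinf N'
          exact ⟨i+1, by omega, h⟩
  exact this _ h0 π rfl hπ

theorem badSeq_shift (c : ℕ → ℕ) (k : ℕ) (h : BadSeq c) : BadSeq (fun i => c (i + k)) := by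
  obtain ⟨j, hj, ⟨N, hN⟩, hinf⟩ := h
  refine ⟨j, hj, ⟨N, fun i hi => hN _ (by omega)⟩, fun N' => ?_⟩
  obtain ⟨i, hi, h⟩ := hinf (N' + k)
  exact ⟨i - k, by omega, by simpa [Nat.sub_add_cancel (show k ≤ i by omega)] using h⟩

end Par

section Conv
open Filter Topology

theorem convex_hit {n : ℕ} (C : ℕ → Set (EuclideanSpace ℝ (Fin n)))
    (hconv : ∀ N, Convex ℝ (C N)) (hcomp : ∀ N, IsCompact (C N)) (hne : ∀ N, (C N).Nonempty)
    (B : ℝ) (hB : ∀ N, ∀ c ∈ C N, ‖c‖ ≤ B) (q : EuclideanSpace ℝ (Fin n))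
    (hw : ∀ w : EuclideanSpace ℝ (Fin n),
      (∀ ε > 0, ∃ᶠ N in atTop, ∀ c ∈ C N, inner ℝ w c ≤ inner ℝ w q + ε) →
      ∀ N, ∀ c ∈ C N, inner ℝ w c = inner ℝ w q) : ∃ N, q ∈ C N := by
  by_contra hcon
  push Not at hcon
  have h1 : ∀ N, ∃ v ∈ C N, ∀ c ∈ C N, inner ℝ (q - v) (c - v) ≤ 0 := by
    intro N
    obtain ⟨v, hv, h⟩ := exists_norm_eq_iInf_of_complete_convex (hne N)
      (hcomp N).isComplete (hconv N) q
    exact ⟨v, hv, (norm_eq_iInf_iff_real_inner_le_zero (hconv N) hv).1 h⟩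
  choose v hv hvi using h1
  let U : Submodule ℝ (EuclideanSpace ℝ (Fin n)) :=
    Submodule.span ℝ {y | ∃ N, ∃ c ∈ C N, y = q - c}
  have ha0 : ∀ N, 0 < ‖q - v N‖ := by
    intro N
    rw [norm_pos_iff, sub_ne_zero]
    intro h
    exact hcon N (h ▸ hv N)
  let w : ℕ → EuclideanSpace ℝ (Fin n) := fun N => (‖q - v N‖⁻¹) • (q - v N)
  have hwU : ∀ N, w N ∈ U := fun N => U.smul_mem _ (Submodule.subset_span ⟨N, v N, hv N, rfl⟩)
  have hwn : ∀ N, ‖w N‖ = 1 := by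
    intro N
    simp only [w, norm_smul, norm_inv, norm_norm]
    exact inv_mul_cancel₀ (ha0 N).ne'
  have hwc : ∀ N, ∀ c ∈ C N, inner ℝ (w N) (c - q) ≤ 0 := by
    intro N c hc
    have h2 : inner ℝ (q - v N) (c - q) ≤ 0 := by
      have := hvi N c hc
      have e : c - q = (c - v N) - (q - v N) := by abel
      rw [e, inner_sub_right]
      have := real_inner_self_nonneg (x := q - v N)
      linarith
    simp only [w, real_inner_smul_left]
    exact mul_nonpos_of_nonneg_of_nonpos (inv_nonneg.2 (norm_nonneg _)) h2
  have hK : IsCompact ((U : Set (EuclideanSpace ℝ (Fin n))) ∩ Metric.sphere 0 1) :=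
    (isCompact_sphere 0 1).inter_left U.closed_of_finiteDimensional
  obtain ⟨l, hl, ψ, hψ, hlim⟩ := hK.tendsto_subseq (x := w)
    (fun N => ⟨hwU N, by simpa using hwn N⟩)
  have hperp := hw l ?_
  · have hU : ∀ y ∈ U, inner ℝ l y = 0 := by
      intro y hy
      induction hy using Submodule.span_induction with
      | mem x hx =>
        obtain ⟨N, c, hc, rfl⟩ := hx
        rw [inner_sub_right, hperp N c hc, sub_self]
      | zero => simp
      | add x y _ _ hx hy => rw [inner_add_right, hx, hy, add_zero]
      | smul a x _ hx => rw [real_inner_smul_right, hx, mul_zero]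
    have h3 := hU l hl.1
    have h4 : ‖l‖ = 1 := by simpa using hl.2
    rw [real_inner_self_eq_norm_sq, h4] at h3
    norm_num at h3
  · intro ε hε
    have hB0 : 0 ≤ B := by
      obtain ⟨c, hc⟩ := hne 0
      exact (norm_nonneg c).trans (hB 0 c hc)
    have hpos : 0 < B + ‖q‖ + 1 := by positivity
    have hev : ∀ᶠ k in atTop, dist (w (ψ k)) l < ε / (B + ‖q‖ + 1) :=
      Metric.tendsto_nhds.1 hlim _ (by positivity)
    have hev2 : ∀ᶠ k in atTop, ∀ c ∈ C (ψ k), inner ℝ l c ≤ inner ℝ l q + ε := by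
      filter_upwards [hev] with k hk c hc
      have e : inner ℝ l c - inner ℝ l q =
          inner ℝ (l - w (ψ k)) (c - q) + inner ℝ (w (ψ k)) (c - q) := by
        rw [← inner_add_left, sub_add_cancel, inner_sub_right]
      have h5 := hwc _ c hc
      have h6 : inner ℝ (l - w (ψ k)) (c - q) ≤ ‖l - w (ψ k)‖ * ‖c - q‖ := real_inner_le_norm _ _
      have h7 : ‖c - q‖ ≤ B + ‖q‖ + 1 := by
        have := norm_sub_le c q
        have := hB _ c hc
        linarith
      have h8 : ‖l - w (ψ k)‖ ≤ ε / (B + ‖q‖ + 1) := by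
        rw [← dist_eq_norm, dist_comm]; exact hk.le
      have h9 : ‖l - w (ψ k)‖ * ‖c - q‖ ≤ ε / (B + ‖q‖ + 1) * (B + ‖q‖ + 1) :=
        mul_le_mul h8 h7 (norm_nonneg _) (by positivity)
      rw [div_mul_cancel₀ _ hpos.ne'] at h9
      linarith
    exact hψ.tendsto_atTop.frequently hev2.frequently

end Conv

section Block

def qmode {M : MDP S Act} (σ : Strategy M) (hq : S → σ.Q) : List S → S → σ.Q
  | [], s => hq s
  | (a :: l), _ => (a :: l).foldl σ.next (hq a)

theorem qmode_snoc {M : MDP S Act} (σ : Strategy M) (hq : S → σ.Q) (l : List S) (s t : S) :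
    qmode σ hq (l ++ [s]) t = σ.next (qmode σ hq l s) s := by
  cases l with
  | nil => rfl
  | cons a l => simp [qmode, List.foldl_append]

noncomputable def blockStrat {M : MDP S Act} (σ : Strategy M) (hq : S → σ.Q) (L : ℕ) (hL : 0 < L) :
    Strategy M where
  Q := {l : List S // l.length < L}
  countable := by
    have : Finite {l : List S // l.length < L} := (List.finite_length_lt S L).to_subtype
    infer_instance
  init := ⟨[], hL⟩
  next l s := if h : l.1.length + 1 < L then ⟨l.1 ++ [s], by simpa using h⟩ else ⟨[], hL⟩
  out l s := σ.out (qmode σ hq l.1 s) s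
  out_sum l s := σ.out_sum _ _
  out_enabled l s a h := σ.out_enabled _ _ _ h

variable (M : MDP S Act) (σ : Strategy M) (hq : S → σ.Q) (L : ℕ) (hL : 0 < L)

theorem blockStrat_finite : (blockStrat σ hq L hL).FiniteMemory :=
  (List.finite_length_lt S L).to_subtype

theorem kr_block (s : S) (l : (blockStrat σ hq L hL).Q) (t : S) :
    kr M (blockStrat σ hq L hL) (s, l) t = kr M σ (s, qmode σ hq l.1 s) t := rfl

theorem ev_block (f : S × (blockStrat σ hq L hL).Q → ℝ) (m : ℕ) :
    ∀ (l : (blockStrat σ hq L hL).Q) (s : S), l.1.length + (m+1) = L →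
      ev M (blockStrat σ hq L hL) (m+1) f (s, l) =
        ev M σ (m+1) (fun y => f (y.1, ⟨[], hL⟩)) (s, qmode σ hq l.1 s) := by
  induction m with
  | zero =>
    intro l s hl
    simp only [ev, kr_block]
    have : (blockStrat σ hq L hL).next l s = ⟨[], hL⟩ := dif_neg (by omega)
    simp only [this]
  | succ m ih =>
    intro l s hl
    rw [ev, ev]
    have hlt : l.1.length + 1 < L := by omega
    have : (blockStrat σ hq L hL).next l s = ⟨l.1 ++ [s], by simpa using hlt⟩ := dif_pos hlt
    simp only [this, kr_block]
    refine Finset.sum_congr rfl fun t _ => ?_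
    have hl' : (l.1 ++ [s]).length + (m+1) = L := by
      rw [List.length_append, List.length_singleton]; omega
    have h := ih ⟨l.1 ++ [s], by simpa using hlt⟩ t hl'
    have h2 := qmode_snoc σ hq l.1 s t
    refine congrArg _ (h.trans ?_)
    exact congrArg (fun q => ev M σ (m + 1) (fun y => f (y.1, ⟨[], hL⟩)) (t, q)) h2

theorem ev_block_init (f : S × (blockStrat σ hq L hL).Q → ℝ) (s : S) :
    ev M (blockStrat σ hq L hL) L f (s, (blockStrat σ hq L hL).init) =
      ev M σ L (fun y => f (y.1, (blockStrat σ hq L hL).init)) (s, hq s) := by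
  obtain ⟨m, rfl⟩ : ∃ m, L = m + 1 := ⟨L - 1, by omega⟩
  exact ev_block M σ hq (m+1) hL f m ⟨[], hL⟩ s (by simp)

def RN (s : S) : Set (S × σ.Q) :=
  {x | Relation.ReflTransGen (fun x y => 0 < M.step σ x y) (s, σ.init) x}

def WS (s : S) : Set S := {t | ∃ q, (t, q) ∈ RN M σ s}

theorem RN_init (s : S) : (s, σ.init) ∈ RN M σ s := Relation.ReflTransGen.refl

theorem RN_closed (s : S) : ∀ x ∈ RN M σ s, ∀ s', 0 < kr M σ x s' →
    (s', σ.next x.2 x.1) ∈ RN M σ s := by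
  intro x hx s' h
  exact Relation.ReflTransGen.tail hx ((step_pos_iff M σ _ _).2 ⟨rfl, h⟩)

theorem exists_block (s : S) (φ : S → ℕ) (hs : M.Sure σ s (ParityObj φ)) :
    ∃ hq : S → σ.Q, (∀ t ∈ WS M σ s, (t, hq t) ∈ RN M σ s) ∧
      ∀ L (hL : 0 < L), ∀ t ∈ WS M σ s, M.Sure (blockStrat σ hq L hL) t (ParityObj φ) := by
  obtain ⟨O, lo, wf, sig, hsig⟩ := sig_main (fun x y => 0 < M.step σ x y) (RN M σ s)
    (fun x => φ x.1) (fun x hx y h => Relation.ReflTransGen.tail hx h)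
    (by
      intro π h0 hπ
      refine good_reach _ (fun x : S × σ.Q => φ x.1) (s, σ.init) ?_ π h0 hπ
      intro π h0 hπ
      exact (parity_iff φ (fun i => (π i).1)).1 (hs ⟨h0, hπ⟩))
    (Finset.univ.sup φ) (fun x => Finset.le_sup (Finset.mem_univ x.1))
  have hmin : ∀ t, ∃ q, t ∈ WS M σ s → (t, q) ∈ RN M σ s ∧
      ∀ q', (t, q') ∈ RN M σ s → sig (t, q) ≤ sig (t, q') := by
    intro t
    by_cases ht : t ∈ WS M σ s
    · obtain ⟨q0, hq0⟩ := ht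
      obtain ⟨o, ⟨q, hq, rfl⟩, ho⟩ := wf.wf.has_min
        {o | ∃ q, (t, q) ∈ RN M σ s ∧ sig (t, q) = o} ⟨_, q0, hq0, rfl⟩
      exact ⟨q, fun _ => ⟨hq, fun q' hq' => not_lt.1 (ho _ ⟨q', hq', rfl⟩)⟩⟩
    · exact ⟨σ.init, fun h => absurd h ht⟩
  choose hq hhq using hmin
  refine ⟨hq, fun t ht => (hhq t ht).1, ?_⟩
  rintro L hL t ht ω ⟨h0, hω⟩
  refine (parity_iff φ _).2 ?_
  let π : ℕ → S × σ.Q := fun i => ((ω i).1, qmode σ hq (ω i).2.1 (ω i).1)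
  have hst : ∀ i, 0 < M.step σ (π i) ((ω (i+1)).1, σ.next (π i).2 (π i).1) := by
    intro i
    rw [step_pos_iff]
    exact ⟨rfl, ((step_pos_iff M _ _ _).1 (hω i)).2⟩
  have hnx : ∀ i, π (i+1) = ((ω (i+1)).1, σ.next (π i).2 (π i).1) ∨
      π (i+1) = ((ω (i+1)).1, hq (ω (i+1)).1) := by
    intro i
    have h1 := ((step_pos_iff M _ _ _).1 (hω i)).1
    by_cases hl : (ω i).2.1.length + 1 < L
    · left
      have h2 : (ω (i+1)).2.1 = (ω i).2.1 ++ [(ω i).1] := by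
        rw [← h1]; simp only [blockStrat, dif_pos hl]
      simp only [π, h2, qmode_snoc]
    · right
      have h2 : (ω (i+1)).2.1 = [] := by
        rw [← h1]; simp only [blockStrat, dif_neg hl]
      simp only [π, h2, qmode]
  have hR : ∀ i, π i ∈ RN M σ s := by
    intro i
    induction i with
    | zero =>
      have : π 0 = (t, hq t) := by simp only [π, h0]; rfl
      rw [this]; exact (hhq t ht).1
    | succ i ih =>
      have hy := Relation.ReflTransGen.tail ih (hst i)
      rcases hnx i with h | h
      · rw [h]; exact hy
      · rw [h]; exact (hhq _ ⟨_, hy⟩).1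
  refine hsig π hR fun i => ⟨_, hst i, ?_⟩
  have hy := Relation.ReflTransGen.tail (hR i) (hst i)
  rcases hnx i with h | h
  · rw [h]
  · rw [h]; exact (hhq _ ⟨_, hy⟩).2 _ hy

end Block

section Gpart
open Filter Topology

variable (M : MDP S Act) (σ : Strategy M) (s : S) {n : ℕ} (F : Fin n → Set S)

def ZS : Set S := {t | t ∈ WS M σ s ∧ ∀ ε > 0, ∃ q, (t, q) ∈ RN M σ s ∧
  val M σ (⋃ i, F i) (t, q) < ε}

theorem exists_delta : ∃ δ > 0, ∀ x ∈ RN M σ s, x.1 ∉ ZS M σ s F →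
    δ ≤ val M σ (⋃ i, F i) x := by
  have h : ∀ t : S, ∃ ε > 0, t ∉ ZS M σ s F → ∀ q, (t, q) ∈ RN M σ s →
      ε ≤ val M σ (⋃ i, F i) (t, q) := by
    intro t
    by_cases ht : t ∈ ZS M σ s F
    · exact ⟨1, one_pos, fun h => absurd ht h⟩
    · by_cases hW : t ∈ WS M σ s
      · have ht' := ht
        simp only [ZS, Set.mem_ofPred_eq, not_and] at ht'
        have := ht' hW
        push Not at this
        obtain ⟨ε, hε, h⟩ := this
        exact ⟨ε, hε, fun _ => h⟩
      · exact ⟨1, one_pos, fun _ q hq => absurd ⟨q, hq⟩ hW⟩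
  choose ε hε h using h
  refine ⟨Finset.univ.inf' Finset.univ_nonempty ε, ?_, ?_⟩
  · rw [gt_iff_lt, Finset.lt_inf'_iff]; exact fun t _ => hε t
  · intro x hx hz
    exact (Finset.inf'_le _ (Finset.mem_univ x.1)).trans (h x.1 hz x.2 hx)

theorem not_mem_ZS (hF : ∀ t ∈ ⋃ i, F i, M.IsSink t) (t : S) (ht : t ∈ ⋃ i, F i) :
    t ∉ ZS M σ s F := by
  rintro ⟨_, h⟩
  obtain ⟨q, _, h⟩ := h 1 one_pos
  rw [val_sink M σ _ _ (hF t ht)] at h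
  simp [ind, Set.mem_iUnion.1 ht] at h

theorem exists_L (hF : ∀ t ∈ ⋃ i, F i, M.IsSink t) (hq : S → σ.Q)
    (hhq : ∀ t ∈ WS M σ s, (t, hq t) ∈ RN M σ s) :
    ∃ L, 0 < L ∧ ∀ t ∈ WS M σ s, t ∉ ZS M σ s F → 0 < rn M σ (⋃ i, F i) L (t, hq t) := by
  obtain ⟨δ, hδ, h⟩ := exists_delta M σ s F
  have h1 : ∀ t, ∃ k, t ∈ WS M σ s → t ∉ ZS M σ s F → 0 < rn M σ (⋃ i, F i) k (t, hq t) := by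
    intro t
    by_cases ht : t ∈ WS M σ s ∧ t ∉ ZS M σ s F
    · obtain ⟨k, hk⟩ := exists_lt_of_lt_ciSup (hδ.trans_le (h _ (hhq t ht.1) ht.2))
      exact ⟨k, fun _ _ => hk⟩
    · exact ⟨0, fun h1 h2 => absurd ⟨h1, h2⟩ ht⟩
  choose k hk using h1
  refine ⟨Finset.univ.sup k + 1, by omega, fun t h1 h2 => (hk t h1 h2).trans_le ?_⟩
  refine rn_mono M σ _ hF _ ?_
  exact (Finset.le_sup (f := k) (Finset.mem_univ t)).trans (by omega)

theorem exists_g1 (hF : ∀ t ∈ ⋃ i, F i, M.IsSink t) (hq : S → σ.Q) (L : ℕ) (hL : 0 < L)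
    (i : Fin n) : ∃ g : S → ℝ, (∀ t, 0 ≤ g t) ∧ (∀ t, g t ≤ 1) ∧ (∀ t ∈ ZS M σ s F, g t = 0) ∧
      (∀ t ∈ ⋃ i, F i, g t = ind (F i) t) ∧
      (∀ t, t ∉ ZS M σ s F → g t = ev M σ L (fun y => g y.1) (t, hq t)) ∧
      (∀ t, g t ≤ val M (blockStrat σ hq L hL) (F i) (t, (blockStrat σ hq L hL).init)) := by
  let Ψ : (S → ℝ) → S → ℝ := fun G t =>
    if t ∈ ZS M σ s F then 0 else ev M σ L (fun y => G y.1) (t, hq t)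
  have hFi : ∀ t ∈ F i, t ∈ ⋃ i, F i := fun t ht => Set.mem_iUnion.2 ⟨i, ht⟩
  have hmono : ∀ G H : S → ℝ, (∀ t, G t ≤ H t) → ∀ t, Ψ G t ≤ Ψ H t := by
    intro G H h t
    simp only [Ψ]
    split_ifs
    · exact le_rfl
    · exact ev_mono M σ _ _ (fun y => h y.1) L _
  let G : ℕ → S → ℝ := fun k => Ψ^[k] (ind (F i))
  have hGs : ∀ k, G (k+1) = Ψ (G k) := fun k => Function.iterate_succ_apply' Ψ k _
  have hG0 : G 0 = ind (F i) := rfl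
  have hG01 : ∀ t, G 0 t ≤ G 1 t := by
    intro t
    rw [hGs 0, hG0]
    simp only [Ψ]
    by_cases ht : t ∈ F i
    · rw [if_neg (not_mem_ZS M σ s F hF t (hFi t ht)),
        ev_sink M σ _ (ind (F i) t) L (t, hq t) (hF t (hFi t ht)) (fun q => rfl)]
    · have : ind (F i) t = 0 := if_neg ht
      rw [this]
      split_ifs
      · exact le_rfl
      · exact ev_nonneg M σ _ (fun _ => ind_nonneg _ _) _ _
  have hGm : ∀ k t, G k t ≤ G (k+1) t := by
    intro k
    induction k with
    | zero => exact hG01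
    | succ k ih => intro t; have h := hmono _ _ ih t; rwa [← hGs, ← hGs] at h
  have hGn : ∀ k t, 0 ≤ G k t := by
    intro k
    induction k with
    | zero => exact fun t => ind_nonneg _ _
    | succ k ih => exact fun t => (ih t).trans (hGm k t)
  have hG1 : ∀ k t, G k t ≤ 1 := by
    intro k
    induction k with
    | zero => exact fun t => ind_le_one _ _
    | succ k ih =>
      intro t
      rw [hGs]
      simp only [Ψ]
      split_ifs
      · exact zero_le_one
      · rw [← ev_const M σ 1 L (t, hq t)]; exact ev_mono M σ _ _ (fun y => ih y.1) L _
  have hbdd : ∀ t, BddAbove (Set.range fun k => G k t) := fun t =>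
    ⟨1, by rintro _ ⟨k, rfl⟩; exact hG1 k t⟩
  have hlim : ∀ t, Tendsto (fun k => G k t) atTop (𝓝 (⨆ k, G k t)) := fun t =>
    tendsto_atTop_ciSup (monotone_nat_of_le_succ fun k => hGm k t) (hbdd t)
  have hfix : ∀ t, (⨆ k, G k t) = Ψ (fun t => ⨆ k, G k t) t := by
    intro t
    have h1 := (hlim t).comp (tendsto_add_atTop_nat 1)
    refine tendsto_nhds_unique h1 ?_
    have : ((fun k => G k t) ∘ fun a => a + 1) = fun k => Ψ (G k) t := by
      funext k; simp only [Function.comp, hGs]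
    rw [this]
    simp only [Ψ]
    split_ifs
    · exact tendsto_const_nhds
    · exact ev_tendsto M σ (fun k y => G k y.1) _ (fun x => hlim x.1) L _
  refine ⟨fun t => ⨆ k, G k t, fun t => (hGn 0 t).trans (le_ciSup (hbdd t) 0),
    fun t => ciSup_le fun k => hG1 k t, fun t ht => ?_, fun t ht => ?_, fun t ht => ?_, fun t => ?_⟩
  · show (⨆ k, G k t) = 0
    rw [hfix]; exact if_pos ht
  · have : ∀ k, G k t = ind (F i) t := by
      intro k
      induction k with
      | zero => rfl
      | succ k ih =>
        rw [hGs]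
        simp only [Ψ]
        rw [if_neg (not_mem_ZS M σ s F hF t ht)]
        exact ev_sink M σ _ _ L (t, hq t) (hF t ht) (fun q => ih)
    simp only [this]
    exact ciSup_const
  · show (⨆ k, G k t) = _
    rw [hfix]; exact if_neg ht
  · refine ciSup_le fun k => ?_
    have : ∀ k t, G k t ≤ rn M (blockStrat σ hq L hL) (F i) (k * L)
        (t, (blockStrat σ hq L hL).init) := by
      intro k
      induction k with
      | zero => intro t; rw [zero_mul]; exact le_rfl
      | succ k ih =>
        intro t
        rw [hGs]
        by_cases ht : t ∈ ZS M σ s F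
        · simp only [Ψ]; rw [if_pos ht]; exact rn_nonneg _ _ _ _ _
        · simp only [Ψ]; rw [if_neg ht, add_mul, one_mul, add_comm, rn, ev_add_time, ev_block_init]
          exact ev_mono M σ _ _ (fun y => ih y.1) L _
    exact (this k t).trans (rn_le_val _ _ _ _ _)

end Gpart

section Real
open Filter Topology

def URealizable (M : MDP S Act) (φ : S → ℕ) {n : ℕ} (F : Fin n → Set S) (W : Set S)
    (d : S → Fin n → ℝ) : Prop :=
  ∃ τ : Strategy M, τ.FiniteMemory ∧ ∀ t ∈ W, M.Sure τ t (ParityObj φ) ∧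
    ∀ i, d t i ≤ val M τ (F i) (t, τ.init)

noncomputable def mixStrat {M : MDP S Act} (τ : S → Strategy M) (l : S → Act → ℝ)
    (h0 : ∀ t a, 0 ≤ l t a) (h1 : ∀ t, ∑ a, l t a = 1)
    (hen : ∀ t a, l t a ≠ 0 → (∑ s', M.P t a s') = 1) : Strategy M where
  Q := Option (Σ t, (τ t).Q)
  countable := by
    have := fun t => (τ t).countable
    infer_instance
  init := none
  next q t := match q with
    | none => some ⟨t, (τ t).init⟩
    | some ⟨u, q⟩ => some ⟨u, (τ u).next q t⟩
  out q t := match q with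
    | none => fun a => ENNReal.ofReal (l t a)
    | some ⟨u, q⟩ => (τ u).out q t
  out_sum q t := by
    rcases q with _ | ⟨u, q⟩
    · show ∑ a, ENNReal.ofReal (l t a) = 1
      rw [← ENNReal.ofReal_sum_of_nonneg (fun _ _ => h0 _ _), h1, ENNReal.ofReal_one]
    · exact (τ u).out_sum q t
  out_enabled q t a h := by
    rcases q with _ | ⟨u, q⟩
    · exact hen t a (fun h' => h (by simp [h']))
    · exact (τ u).out_enabled q t a h

variable (M : MDP S Act) (τ : S → Strategy M) (l : S → Act → ℝ)
    (h0 : ∀ t a, 0 ≤ l t a) (h1 : ∀ t, ∑ a, l t a = 1)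
    (hen : ∀ t a, l t a ≠ 0 → (∑ s', M.P t a s') = 1)

theorem kr_mix_some (u t t' : S) (q : (τ u).Q) :
    kr M (mixStrat τ l h0 h1 hen) (t, some ⟨u, q⟩) t' = kr M (τ u) (t, q) t' := rfl

theorem kr_mix_none (t t' : S) :
    kr M (mixStrat τ l h0 h1 hen) (t, none) t' = ∑ a, l t a * pr M t a t' := by
  refine Finset.sum_congr rfl fun a _ => ?_
  show (ENNReal.ofReal (l t a)).toReal * _ = _
  rw [ENNReal.toReal_ofReal (h0 t a)]

theorem ev_mix_some (f : S → ℝ) (m : ℕ) : ∀ (u t : S) (q : (τ u).Q),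
    ev M (mixStrat τ l h0 h1 hen) m (fun y => f y.1) (t, some ⟨u, q⟩) =
      ev M (τ u) m (fun y => f y.1) (t, q) := by
  induction m with
  | zero => intros; rfl
  | succ m ih =>
    intro u t q
    rw [ev, ev]
    exact Finset.sum_congr rfl fun t' _ => congrArg _ (ih u t' _)

theorem val_mix_some (G : Set S) (u t : S) (q : (τ u).Q) :
    val M (mixStrat τ l h0 h1 hen) G (t, some ⟨u, q⟩) = val M (τ u) G (t, q) := by
  unfold val rn
  exact iSup_congr fun m => ev_mix_some M τ l h0 h1 hen (ind G) m u t q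

theorem val_mix_none (G : Set S) (hG : ∀ s ∈ G, M.IsSink s) (t : S) :
    val M (mixStrat τ l h0 h1 hen) G (t, none) =
      ∑ t', (∑ a, l t a * pr M t a t') * val M (τ t) G (t', (τ t).init) := by
  rw [← val_ev M _ G hG 1, ev]
  refine Finset.sum_congr rfl fun t' _ => ?_
  rw [kr_mix_none]
  exact congrArg _ (val_mix_some M τ l h0 h1 hen G t t' _)

theorem sure_mix (φ : S → ℕ) (W : Set S) (t : S)
    (hcl : ∀ t', 0 < ∑ a, l t a * pr M t a t' → t' ∈ W)
    (hs : ∀ t' ∈ W, M.Sure (τ t) t' (ParityObj φ)) :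
    M.Sure (mixStrat τ l h0 h1 hen) t (ParityObj φ) := by
  rintro ω ⟨hω0, hω⟩
  have hst := fun i => (step_pos_iff M _ _ _).1 (hω i)
  have hq : ∀ i, ∃ q : (τ t).Q, (ω (i+1)).2 = some ⟨t, q⟩ ∧ (i = 0 → q = (τ t).init) := by
    intro i
    induction i with
    | zero => exact ⟨(τ t).init, by rw [← (hst 0).1, hω0]; rfl, fun _ => rfl⟩
    | succ i ih =>
      obtain ⟨q, hq, _⟩ := ih
      exact ⟨(τ t).next q (ω (i+1)).1, by rw [← (hst (i+1)).1, hq]; rfl, fun h => by omega⟩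
  choose q hq hq0 using hq
  have hω' : ∀ i, ω (i+1) = ((ω (i+1)).1, some ⟨t, q i⟩) := fun i => Prod.ext rfl (hq i)
  refine (parity_iff φ _).2 fun hbad => ?_
  have hW : (ω 1).1 ∈ W := by
    have h := (hst 0).2
    rw [hω0] at h
    exact hcl _ ((kr_mix_none M τ l h0 h1 hen t _) ▸ h)
  have hp : (fun i => ((ω (i+1)).1, q i)) ∈ PathsFrom (M.step (τ t)) ((ω 1).1, (τ t).init) := by
    refine ⟨by simp [hq0 0 rfl], fun i => ?_⟩
    rw [step_pos_iff]
    have h := hst (i+1)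
    constructor
    · have h2 := h.1
      rw [hq (i+1), hq i] at h2
      have h3 : some (⟨t, (τ t).next (q i) (ω (i+1)).1⟩ : Σ t, (τ t).Q) = some ⟨t, q (i+1)⟩ := h2
      simpa using h3
    · have h2 := h.2
      rw [hω' i] at h2
      exact h2
  exact (parity_iff φ _).1 (hs _ hW hp) (badSeq_shift _ 1 hbad)

theorem urealizable_step (φ : S → ℕ) {n : ℕ} (F : Fin n → Set S) (hF : ∀ t ∈ ⋃ i, F i, M.IsSink t)
    (W : Set S) (hcl : ∀ t ∈ W, ∀ t', 0 < ∑ a, l t a * pr M t a t' → t' ∈ W)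
    (h0 : ∀ t a, 0 ≤ l t a) (h1 : ∀ t, ∑ a, l t a = 1)
    (hen : ∀ t a, l t a ≠ 0 → (∑ s', M.P t a s') = 1)
    (d : S → S → Fin n → ℝ) (hd : ∀ t, URealizable M φ F W (d t)) :
    URealizable M φ F W (fun t i => ∑ t', (∑ a, l t a * pr M t a t') * d t t' i) := by
  choose τ hfin hτ using hd
  refine ⟨mixStrat τ l h0 h1 hen, ?_, fun t ht => ⟨?_, fun i => ?_⟩⟩
  · have : ∀ t, Finite (τ t).Q := hfin
    exact (inferInstance : Finite (Option (Σ t, (τ t).Q)))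
  · exact sure_mix M τ l h0 h1 hen φ W t (hcl t ht) (fun t' ht' => (hτ t t' ht').1)
  · have := val_mix_none M τ l h0 h1 hen (F i) (fun s hs => hF s (Set.mem_iUnion.2 ⟨i, hs⟩)) t
    refine le_trans ?_ this.ge
    refine Finset.sum_le_sum fun t' _ => ?_
    have hn : 0 ≤ ∑ a, l t a * pr M t a t' :=
      Finset.sum_nonneg fun a _ => mul_nonneg (h0 t a) (pr_nonneg M _ _ _)
    rcases hn.eq_or_lt with h | h
    · rw [← h, zero_mul, zero_mul]
    · exact mul_le_mul_of_nonneg_left ((hτ t t' (hcl t ht t' h)).2 i) hn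

end Real

section Sets
open Filter Topology

def Lam (Al : S → Act → Prop) (t : S) : Set (Act → ℝ) :=
  {l | (∀ a, 0 ≤ l a) ∧ ∑ a, l a = 1 ∧ ∀ a, ¬ Al t a → l a = 0}

noncomputable def wt (M : MDP S Act) (t : S) (l : Act → ℝ) (t' : S) : ℝ := ∑ a, l a * pr M t a t'

noncomputable def mixv (M : MDP S Act) {n : ℕ} (t : S)
    (p : (Act → ℝ) × (S → EuclideanSpace ℝ (Fin n))) : EuclideanSpace ℝ (Fin n) :=
  ∑ t', wt M t p.1 t' • p.2 t'

noncomputable def DN (M : MDP S Act) (Al : S → Act → Prop) {n : ℕ}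
    (g : S → EuclideanSpace ℝ (Fin n)) : ℕ → S → Set (EuclideanSpace ℝ (Fin n))
  | 0, t => {g t}
  | N+1, t => mixv M t '' (Lam Al t ×ˢ Set.pi Set.univ (DN M Al g N))

variable (M : MDP S Act) (Al : S → Act → Prop) {n : ℕ} (g : S → EuclideanSpace ℝ (Fin n))

theorem wt_nonneg (t : S) (l : Act → ℝ) (hl : l ∈ Lam Al t) (t' : S) : 0 ≤ wt M t l t' :=
  Finset.sum_nonneg fun a _ => mul_nonneg (hl.1 a) (pr_nonneg M _ _ _)

theorem wt_sum (hen : ∀ t a, Al t a → (∑ s', M.P t a s') = 1) (t : S) (l : Act → ℝ)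
    (hl : l ∈ Lam Al t) : ∑ t', wt M t l t' = 1 := by
  unfold wt
  rw [Finset.sum_comm, ← hl.2.1]
  refine Finset.sum_congr rfl fun a _ => ?_
  rw [← Finset.mul_sum]
  by_cases h : Al t a
  · rw [pr_sum M t a (hen t a h), mul_one]
  · rw [hl.2.2 a h, zero_mul]

theorem Lam_single (t : S) (a : Act) (ha : Al t a) : Pi.single a 1 ∈ Lam Al t := by
  refine ⟨fun b => ?_, by simp, fun b hb => ?_⟩
  · by_cases h : b = a
    · subst h; simp
    · simp [h]
  · have : b ≠ a := fun h => hb (h ▸ ha)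
    simp [this]

theorem wt_single (t : S) (a : Act) (t' : S) : wt M t (Pi.single a 1) t' = pr M t a t' := by
  simp [wt, Pi.single_apply]

theorem Lam_compact (t : S) : IsCompact (Lam Al t) := by
  have : Lam Al t = stdSimplex ℝ Act ∩ {l | ∀ a, ¬ Al t a → l a = 0} := by
    ext l; simp only [Lam, stdSimplex, Set.mem_inter_iff, Set.mem_ofPred_eq, and_assoc]
  rw [this]
  refine (isCompact_stdSimplex ℝ Act).inter_right ?_
  have e : {l : Act → ℝ | ∀ a, ¬ Al t a → l a = 0} = ⋂ a, ⋂ (_ : ¬ Al t a), {l | l a = 0} := by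
    ext l; simp
  rw [e]
  exact isClosed_iInter fun a => isClosed_iInter fun _ => isClosed_eq (continuous_apply a) continuous_const

theorem mixv_continuous (t : S) : Continuous (mixv M (n := n) t) := by
  unfold mixv wt
  fun_prop

theorem DN_compact (N : ℕ) : ∀ t, IsCompact (DN M Al g N t) := by
  induction N with
  | zero => intro t; exact isCompact_singleton
  | succ N ih =>
    intro t
    exact ((Lam_compact Al t).prod (isCompact_univ_pi ih)).image (mixv_continuous M t)

theorem DN_nonempty (hAl : ∀ t, ∃ a, Al t a) (N : ℕ) : ∀ t, (DN M Al g N t).Nonempty := by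
  induction N with
  | zero => intro t; exact Set.singleton_nonempty _
  | succ N ih =>
    intro t
    obtain ⟨a, ha⟩ := hAl t
    choose d hd using ih
    exact ⟨_, (Pi.single a 1, d), ⟨Lam_single Al t a ha, fun t' _ => hd t'⟩, rfl⟩

theorem DN_convex (N : ℕ) : ∀ t, Convex ℝ (DN M Al g N t) := by
  induction N with
  | zero => intro t; exact convex_singleton _
  | succ N ih =>
    rintro t _ ⟨⟨l1, d1⟩, ⟨hl1, hd1⟩, rfl⟩ _ ⟨⟨l2, d2⟩, ⟨hl2, hd2⟩, rfl⟩ a b ha hb hab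
    simp only [Set.mem_univ_pi] at hl1 hd1 hl2 hd2
    let l : Act → ℝ := fun c => a * l1 c + b * l2 c
    have hl : l ∈ Lam Al t := by
      refine ⟨fun c => add_nonneg (mul_nonneg ha (hl1.1 c)) (mul_nonneg hb (hl2.1 c)), ?_, ?_⟩
      · simp only [l, Finset.sum_add_distrib, ← Finset.mul_sum]
        rw [hl1.2.1, hl2.2.1]; linarith
      · intro c hc
        simp only [l]
        rw [hl1.2.2 c hc, hl2.2.2 c hc]; simp
    have hm : ∀ t', wt M t l t' = a * wt M t l1 t' + b * wt M t l2 t' := by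
      intro t'
      simp only [wt, l, Finset.mul_sum, ← Finset.sum_add_distrib]
      exact Finset.sum_congr rfl fun c _ => by ring
    let d : S → EuclideanSpace ℝ (Fin n) := fun t' => if wt M t l t' = 0 then d1 t' else
      (a * wt M t l1 t' / wt M t l t') • d1 t' + (b * wt M t l2 t' / wt M t l t') • d2 t'
    refine ⟨(l, d), ⟨hl, ?_⟩, ?_⟩
    · rw [Set.mem_univ_pi]
      intro t'
      simp only [d]
      have w1 := mul_nonneg ha (wt_nonneg M Al t l1 hl1 t')
      have w2 := mul_nonneg hb (wt_nonneg M Al t l2 hl2 t')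
      have w := wt_nonneg M Al t l hl t'
      split_ifs with h
      · exact hd1 t'
      · refine ih t' (hd1 t') (hd2 t') (div_nonneg w1 w) (div_nonneg w2 w) ?_
        rw [← add_div, ← hm, div_self h]
    · simp only [mixv, Finset.smul_sum, ← Finset.sum_add_distrib]
      refine Finset.sum_congr rfl fun t' _ => ?_
      have w1 := mul_nonneg ha (wt_nonneg M Al t l1 hl1 t')
      have w2 := mul_nonneg hb (wt_nonneg M Al t l2 hl2 t')
      simp only [d]
      split_ifs with h
      · have h' := hm t'
        have e1 : a * wt M t l1 t' = 0 := by linarith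
        have e2 : b * wt M t l2 t' = 0 := by linarith
        rw [h, smul_smul, smul_smul, e1, e2]; simp
      · rw [smul_add, smul_smul, smul_smul, smul_smul, smul_smul, mul_div_cancel₀ _ h,
          mul_div_cancel₀ _ h]

theorem DN_bdd (hen : ∀ t a, Al t a → (∑ s', M.P t a s') = 1) (B : ℝ) (hB : ∀ t, ‖g t‖ ≤ B)
    (N : ℕ) : ∀ t, ∀ c ∈ DN M Al g N t, ‖c‖ ≤ B := by
  induction N with
  | zero => rintro t _ rfl; exact hB t
  | succ N ih =>
    rintro t _ ⟨⟨l, d⟩, ⟨hl, hd⟩, rfl⟩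
    simp only [Set.mem_univ_pi] at hl hd
    refine (norm_sum_le _ _).trans ?_
    have : ∑ t', wt M t l t' * B = B := by
      rw [← Finset.sum_mul, wt_sum M Al hen t l hl, one_mul]
    rw [← this]
    refine Finset.sum_le_sum fun t' _ => ?_
    rw [norm_smul, Real.norm_of_nonneg (wt_nonneg M Al t l hl t')]
    exact mul_le_mul_of_nonneg_left (ih t' _ (hd t')) (wt_nonneg M Al t l hl t')

theorem DN_real (hen : ∀ t a, Al t a → (∑ s', M.P t a s') = 1) (φ : S → ℕ) (F : Fin n → Set S)
    (hF : ∀ t ∈ ⋃ i, F i, M.IsSink t) (W : Set S)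
    (hW : ∀ t ∈ W, ∀ a, Al t a → ∀ t', 0 < pr M t a t' → t' ∈ W)
    (hg : URealizable M φ F W (fun t i => g t i)) (N : ℕ) :
    ∀ d : S → EuclideanSpace ℝ (Fin n), (∀ t, d t ∈ DN M Al g N t) →
      URealizable M φ F W (fun t i => d t i) := by
  induction N with
  | zero =>
    intro d hd
    have : d = g := funext hd
    rw [this]; exact hg
  | succ N ih =>
    intro d hd
    choose p hp hpd using hd
    have hl : ∀ t, (p t).1 ∈ Lam Al t := fun t => (hp t).1
    have hd' : ∀ t t', (p t).2 t' ∈ DN M Al g N t' := fun t t' => (hp t).2 t' trivial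
    have key := urealizable_step M (fun t => (p t).1) φ F hF W ?_ (fun t => (hl t).1)
      (fun t => (hl t).2.1) (fun t a h => hen t a (by_contra fun h' => h ((hl t).2.2 a h')))
      (fun t t' i => (p t).2 t' i) (fun t => ih _ (hd' t))
    · have e : (fun t i => d t i) = fun t i =>
          ∑ t', (∑ a, (p t).1 a * pr M t a t') * (p t).2 t' i := by
        funext t i
        rw [← hpd t]
        simp [mixv, wt]
      rw [e]; exact key
    · intro t ht t' h
      obtain ⟨a, _, ha⟩ := Finset.exists_ne_zero_of_sum_ne_zero h.ne'
      have h1 : (p t).1 a ≠ 0 := left_ne_zero_of_mul ha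
      have h2 : pr M t a t' ≠ 0 := right_ne_zero_of_mul ha
      exact hW t ht a (by_contra fun h' => h1 ((hl t).2.2 a h')) t'
        (lt_of_le_of_ne (pr_nonneg M _ _ _) h2.symm)

end Sets

section Varg
open Filter Topology

theorem exists_liminf (v : ℕ → ℝ) (C : ℝ) (hC : ∀ N, |v N| ≤ C) :
    ∃ V : ℝ, (∀ ε > 0, ∀ᶠ N in atTop, V - ε ≤ v N) ∧
      (∀ b, (∀ ε > 0, ∀ᶠ N in atTop, b - ε ≤ v N) → b ≤ V) := by
  let A : Set ℝ := {b | ∀ᶠ N in atTop, b ≤ v N}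
  have hne : A.Nonempty := ⟨-C, Eventually.of_forall fun N => (abs_le.1 (hC N)).1⟩
  have hbd : BddAbove A := by
    refine ⟨C, fun b hb => ?_⟩
    obtain ⟨N, hN⟩ := Eventually.exists hb
    exact hN.trans (abs_le.1 (hC N)).2
  refine ⟨sSup A, fun ε hε => ?_, fun b hb => ?_⟩
  · obtain ⟨b, hb, hlt⟩ := exists_lt_of_lt_csSup hne (show sSup A - ε < sSup A by linarith)
    filter_upwards [hb] with N hN
    linarith
  · refine le_of_forall_pos_sub_le fun ε hε => ?_
    exact le_csSup hbd (hb ε hε)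

variable (M : MDP S Act) (σ : Strategy M)

theorem kr_sum_eq (x : S × σ.Q) (f : S → ℝ) : ∑ t', kr M σ x t' * f t' =
    ∑ a, (σ.out x.2 x.1 a).toReal * ∑ t', pr M x.1 a t' * f t' := by
  simp only [kr, Finset.sum_mul, Finset.mul_sum]
  rw [Finset.sum_comm]
  exact Finset.sum_congr rfl fun a _ => Finset.sum_congr rfl fun t' _ => by ring

theorem kr_avg (x : S × σ.Q) (f : S → ℝ) (c : ℝ)
    (h : ∀ a, σ.out x.2 x.1 a ≠ 0 → ∑ t', pr M x.1 a t' * f t' ≤ c) :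
    ∑ t', kr M σ x t' * f t' ≤ c ∧
      (∑ t', kr M σ x t' * f t' = c → ∀ a, σ.out x.2 x.1 a ≠ 0 →
        ∑ t', pr M x.1 a t' * f t' = c) := by
  have h1 : c - ∑ t', kr M σ x t' * f t' =
      ∑ a, (σ.out x.2 x.1 a).toReal * (c - ∑ t', pr M x.1 a t' * f t') := by
    simp only [mul_sub, Finset.sum_sub_distrib]
    rw [kr_sum_eq, ← Finset.sum_mul, out_sum_real, one_mul]
  have h2 : ∀ a ∈ Finset.univ, 0 ≤ (σ.out x.2 x.1 a).toReal * (c - ∑ t', pr M x.1 a t' * f t') := by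
    intro a _
    by_cases ha : σ.out x.2 x.1 a = 0
    · simp [ha]
    · exact mul_nonneg ENNReal.toReal_nonneg (sub_nonneg.2 (h a ha))
  refine ⟨?_, fun he a ha => ?_⟩
  · have := Finset.sum_nonneg h2
    linarith
  · rw [he, sub_self] at h1
    have h3 := (Finset.sum_eq_zero_iff_of_nonneg h2).1 h1.symm a (Finset.mem_univ a)
    have h4 : (σ.out x.2 x.1 a).toReal ≠ 0 :=
      (ENNReal.toReal_pos ha (ne_top_of_le_ne_top ENNReal.one_ne_top (σ.out_le_one _ _ _))).ne'
    rcases mul_eq_zero.1 h3 with h5 | h5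
    · exact absurd h5 h4
    · linarith

def AlS (s t : S) (a : Act) : Prop :=
  (∑ s', M.P t a s') = 1 ∧ (t ∈ WS M σ s → ∃ q, (t, q) ∈ RN M σ s ∧ σ.out q t a ≠ 0)

theorem AlS_exists (s t : S) : ∃ a, AlS M σ s t a := by
  by_cases ht : t ∈ WS M σ s
  · obtain ⟨q, hq⟩ := ht
    have : ∑ a, σ.out q t a ≠ 0 := by rw [σ.out_sum]; exact one_ne_zero
    obtain ⟨a, _, ha⟩ := Finset.exists_ne_zero_of_sum_ne_zero this
    exact ⟨a, σ.out_enabled q t a ha, fun _ => ⟨q, hq, ha⟩⟩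
  · obtain ⟨a, ha⟩ := M.exists_enabled t
    exact ⟨a, ha, fun h => absurd h ht⟩

theorem AlS_closed (s : S) : ∀ t ∈ WS M σ s, ∀ a, AlS M σ s t a → ∀ t', 0 < pr M t a t' →
    t' ∈ WS M σ s := by
  intro t ht a ha t' hp
  obtain ⟨q, hq, ho⟩ := ha.2 ht
  exact ⟨_, RN_closed M σ s _ hq t' (kr_pos_of M σ (x := (t, q)) ho hp)⟩

theorem V_arg (s : S) {n : ℕ} (F : Fin n → Set S) (hF : ∀ t ∈ ⋃ i, F i, M.IsSink t)
    (hq : S → σ.Q) (hhq : ∀ t ∈ WS M σ s, (t, hq t) ∈ RN M σ s) (L : ℕ)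
    (hLr : ∀ t ∈ WS M σ s, t ∉ ZS M σ s F → 0 < rn M σ (⋃ i, F i) L (t, hq t))
    (c0 γ : S → ℝ) (υ : S × σ.Q → ℝ) (C : ℝ) (hC0 : 0 ≤ C)
    (hc0 : ∀ t, t ∉ ⋃ i, F i → c0 t = 0)
    (hυ1 : ∀ m x, ev M σ m υ x = υ x)
    (hυ2 : ∀ x, |υ x| ≤ C * val M σ (⋃ i, F i) x)
    (hυ3 : ∀ x : S × σ.Q, x.1 ∈ ⋃ i, F i → υ x = c0 x.1)
    (hυ4 : ∀ x, Tendsto (fun N => ev M σ N (fun y => c0 y.1) x) atTop (𝓝 (υ x)))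
    (hγC : ∀ t, |γ t| ≤ C) (hγZ : ∀ t ∈ ZS M σ s F, γ t = 0)
    (hγF : ∀ t ∈ ⋃ i, F i, γ t = c0 t)
    (hγL : ∀ t, t ∉ ZS M σ s F → γ t = ev M σ L (fun y => γ y.1) (t, hq t))
    (VN : ℕ → S → ℝ) (hV0 : VN 0 = γ) (hVC : ∀ N t, |VN N t| ≤ C)
    (hVs : ∀ N t a, AlS M σ s t a → ∑ t', pr M t a t' * VN N t' ≤ VN (N+1) t)
    (hVe : ∀ ε > 0, ∃ᶠ N in atTop, VN N s ≤ υ (s, σ.init) + ε) :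
    ∃ V : S → ℝ, V s = υ (s, σ.init) ∧
      (∀ t ∈ WS M σ s, ∀ a, AlS M σ s t a → ∑ t', pr M t a t' * V t' = V t) ∧
      (∀ t ∈ WS M σ s, γ t = V t) := by
  obtain ⟨δ, hδ, hδh⟩ := exists_delta M σ s F
  have hcl := RN_closed M σ s
  have hAlx : ∀ x ∈ RN M σ s, ∀ a, σ.out x.2 x.1 a ≠ 0 → AlS M σ s x.1 a := fun x hx a ha =>
    ⟨σ.out_enabled _ _ _ ha, fun _ => ⟨x.2, hx, ha⟩⟩
  have st1 : ∀ N, ∀ x ∈ RN M σ s, ev M σ N (fun y => γ y.1) x ≤ VN N x.1 := by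
    intro N
    induction N with
    | zero => intro x hx; rw [hV0]; exact le_rfl
    | succ N ih =>
      intro x hx
      refine le_trans ?_ (kr_avg M σ x (VN N) (VN (N+1) x.1)
        (fun a ha => hVs N x.1 a (hAlx x hx a ha))).1
      rw [ev]
      refine Finset.sum_le_sum fun t' _ => ?_
      rcases (kr_nonneg M σ x t').eq_or_lt with h | h
      · rw [← h, zero_mul, zero_mul]
      · exact mul_le_mul_of_nonneg_left (ih _ (hcl x hx t' h)) h.le
  have st2 : ∀ N, ∀ x ∈ RN M σ s, ev M σ N (fun y => c0 y.1) x -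
      C / δ * (val M σ (⋃ i, F i) x - rn M σ (⋃ i, F i) N x) ≤ VN N x.1 := by
    intro N x hx
    refine le_trans ?_ (st1 N x hx)
    have e : ev M σ N (fun y => c0 y.1) x -
      C / δ * (val M σ (⋃ i, F i) x - rn M σ (⋃ i, F i) N x) =
      ev M σ N (fun y => c0 y.1 - C / δ * (val M σ (⋃ i, F i) y - ind (⋃ i, F i) y.1)) x := by
      rw [ev_sub, ev_smul, ev_sub, val_ev M σ _ hF]; rfl
    rw [e]
    refine ev_mono_on M σ (RN M σ s) hcl _ _ (fun y hy => ?_) N x hx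
    have hCδ : 0 ≤ C / δ := div_nonneg hC0 hδ.le
    have hle : ind (⋃ i, F i) y.1 ≤ val M σ (⋃ i, F i) y := rn_le_val M σ _ 0 y
    by_cases hyF : y.1 ∈ ⋃ i, F i
    · rw [hγF _ hyF]
      have := mul_nonneg hCδ (sub_nonneg.2 hle)
      linarith
    · have hi : ind (⋃ i, F i) y.1 = 0 := if_neg hyF
      rw [hc0 _ hyF, hi]
      rw [hi] at hle
      by_cases hyZ : y.1 ∈ ZS M σ s F
      · rw [hγZ _ hyZ]
        have := mul_nonneg hCδ hle
        linarith
      · have h1 := hδh y hy hyZ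
        have h2 := (abs_le.1 (hγC y.1)).1
        have h3 : C ≤ C / δ * val M σ (⋃ i, F i) y := by
          calc C = C / δ * δ := by field_simp
            _ ≤ _ := mul_le_mul_of_nonneg_left h1 hCδ
        linarith
  choose V hVl hVu using fun t => exists_liminf (fun N => VN N t) C (fun N => hVC N t)
  have st3 : ∀ x ∈ RN M σ s, υ x ≤ V x.1 := by
    intro x hx
    refine hVu _ _ fun ε hε => ?_
    have hlim : Tendsto (fun N => ev M σ N (fun y => c0 y.1) x -
      C / δ * (val M σ (⋃ i, F i) x - rn M σ (⋃ i, F i) N x)) atTop (𝓝 (υ x)) := by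
      have h1 := (hυ4 x).sub (((rn_tendsto M σ _ hF x).const_sub (val M σ (⋃ i, F i) x)).const_mul (C/δ))
      simpa using h1
    have h2 := hlim.eventually (lt_mem_nhds (show υ x - ε < υ x by linarith))
    filter_upwards [h2] with N hN
    exact hN.le.trans (st2 N x hx)
  have st4 : ∀ t a, AlS M σ s t a → ∑ t', pr M t a t' * V t' ≤ V t := by
    intro t a ha
    refine hVu _ _ fun ε hε => ?_
    have h1 : ∀ᶠ N in atTop, ∀ t', V t' - ε ≤ VN N t' := eventually_all.2 fun t' => hVl t' ε hε
    obtain ⟨N0, hN0⟩ := eventually_atTop.1 h1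
    refine eventually_atTop.2 ⟨N0 + 1, fun N hN => ?_⟩
    obtain ⟨m, rfl⟩ : ∃ m, N = m + 1 := ⟨N - 1, by omega⟩
    refine le_trans ?_ (hVs m t a ha)
    have h2 : ∑ t', pr M t a t' * V t' - ε = ∑ t', pr M t a t' * (V t' - ε) := by
      simp only [mul_sub, Finset.sum_sub_distrib]
      rw [← Finset.sum_mul, pr_sum M t a ha.1, one_mul]
    rw [h2]
    exact Finset.sum_le_sum fun t' _ =>
      mul_le_mul_of_nonneg_left (hN0 m (by omega) t') (pr_nonneg M _ _ _)
  have st5 : V s ≤ υ (s, σ.init) := by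
    refine le_of_forall_pos_le_add fun ε hε => ?_
    obtain ⟨N, h1, h2⟩ := ((hVe (ε/2) (by linarith)).and_eventually (hVl s (ε/2) (by linarith))).exists
    linarith
  have st6 : ∀ x ∈ RN M σ s, V x.1 = υ x := by
    intro x hx
    have hx' : Relation.ReflTransGen (fun x y => 0 < M.step σ x y) (s, σ.init) x := hx
    induction hx' with
    | refl => exact le_antisymm st5 (st3 _ hx)
    | @tail x y hx1 hxy ih =>
      have hxR : x ∈ RN M σ s := hx1
      have ihx := ih hxR
      obtain ⟨h1, h2⟩ := (step_pos_iff M σ x y).1 hxy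
      have h3 := (kr_avg M σ x V (V x.1) (fun a ha => st4 x.1 a (hAlx x hxR a ha))).1
      have h4 := hυ1 1 x
      simp only [ev] at h4
      have hz : ∑ t', kr M σ x t' * (V t' - υ (t', σ.next x.2 x.1)) ≤ 0 := by
        simp only [mul_sub, Finset.sum_sub_distrib]
        linarith
      have hnn : ∀ t' ∈ Finset.univ, 0 ≤ kr M σ x t' * (V t' - υ (t', σ.next x.2 x.1)) := by
        intro t' _
        rcases (kr_nonneg M σ x t').eq_or_lt with h | h
        · rw [← h, zero_mul]
        · exact mul_nonneg h.le (sub_nonneg.2 (st3 _ (hcl x hxR t' h)))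
      have h5 := (Finset.sum_eq_zero_iff_of_nonneg hnn).1
        (le_antisymm hz (Finset.sum_nonneg hnn)) y.1 (Finset.mem_univ _)
      rcases mul_eq_zero.1 h5 with h6 | h6
      · exact absurd h6 h2.ne'
      · have hy : y = (y.1, σ.next x.2 x.1) := Prod.ext rfl h1.symm
        rw [← hy] at h6
        linarith
  refine ⟨V, st6 _ (RN_init M σ s), ?_, ?_⟩
  · intro t ht a ha
    obtain ⟨q, hqR, ho⟩ := ha.2 ht
    refine (kr_avg M σ (t, q) V (V t) (fun a ha => st4 t a (hAlx _ hqR a ha))).2 ?_ a ho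
    rw [st6 _ hqR, ← hυ1 1 (t, q)]
    simp only [ev]
    refine Finset.sum_congr rfl fun t' _ => ?_
    rcases (kr_nonneg M σ (t, q) t').eq_or_lt with h | h
    · rw [← h, zero_mul, zero_mul]
    · rw [st6 _ (hcl _ hqR t' h)]
  · have hVZ : ∀ t ∈ ZS M σ s F, V t = 0 := by
      intro t ht
      have : |V t| ≤ 0 := by
        refine le_of_forall_pos_le_add fun ε hε => ?_
        obtain ⟨q, hqR, hh⟩ := ht.2 (ε / (C + 1)) (by positivity)
        rw [st6 _ hqR, zero_add]
        refine (hυ2 _).trans ?_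
        have h0 := val_nonneg M σ (⋃ i, F i) (t, q)
        rw [lt_div_iff₀ (by linarith)] at hh
        linarith
      exact abs_nonpos_iff.1 this
    have hVL : ∀ t ∈ WS M σ s, V t = ev M σ L (fun y => V y.1) (t, hq t) := by
      intro t ht
      rw [st6 _ (hhq t ht), ← hυ1 L (t, hq t)]
      exact ev_congr_on M σ _ hcl _ _ (fun y hy => (st6 y hy).symm) L _ (hhq t ht)
    have hs : s ∈ WS M σ s := ⟨_, RN_init M σ s⟩
    obtain ⟨t0, ht0, hmax⟩ := Set.exists_max_image (WS M σ s) (fun t => |γ t - V t|)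
      (Set.toFinite _) ⟨s, hs⟩
    suffices h0 : |γ t0 - V t0| = 0 by
      intro t ht
      have := hmax t ht
      rw [h0] at this
      exact sub_eq_zero.1 (abs_nonpos_iff.1 this)
    by_cases hZ : t0 ∈ ZS M σ s F
    · rw [hγZ _ hZ, hVZ _ hZ]; simp
    have hFz : ∀ t ∈ WS M σ s, t ∈ ⋃ i, F i → γ t - V t = 0 := by
      rintro t ⟨q, hqR⟩ hFt
      rw [hγF t hFt, st6 _ hqR, hυ3 (t, q) hFt, sub_self]
    set m := |γ t0 - V t0| with hm
    have he : γ t0 - V t0 = ev M σ L (fun y => γ y.1 - V y.1) (t0, hq t0) := by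
      rw [ev_sub, ← hγL t0 hZ, ← hVL t0 ht0]
    have hpt : ∀ y ∈ RN M σ s, |γ y.1 - V y.1| ≤ m - m * ind (⋃ i, F i) y.1 := by
      intro y hy
      by_cases hyF : y.1 ∈ ⋃ i, F i
      · rw [hFz y.1 ⟨y.2, hy⟩ hyF]
        have : ind (⋃ i, F i) y.1 = 1 := if_pos hyF
        rw [this]; simp
      · have : ind (⋃ i, F i) y.1 = 0 := if_neg hyF
        rw [this, mul_zero, sub_zero]
        exact hmax y.1 ⟨y.2, hy⟩
    have hev : ev M σ L (fun y => m - m * ind (⋃ i, F i) y.1) (t0, hq t0) =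
        m - m * rn M σ (⋃ i, F i) L (t0, hq t0) := by
      rw [ev_sub, ev_const, ev_smul]; rfl
    have hup : γ t0 - V t0 ≤ m - m * rn M σ (⋃ i, F i) L (t0, hq t0) := by
      rw [he, ← hev]
      exact ev_mono_on M σ _ hcl _ _ (fun y hy => (abs_le.1 (hpt y hy)).2) L _ (hhq t0 ht0)
    have hlo : -(γ t0 - V t0) ≤ m - m * rn M σ (⋃ i, F i) L (t0, hq t0) := by
      have h1 := ev_mono_on M σ _ hcl (fun y => (-1) * (γ y.1 - V y.1))
        (fun y => m - m * ind (⋃ i, F i) y.1)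
        (fun y hy => by have := (abs_le.1 (hpt y hy)).1; linarith) L _ (hhq t0 ht0)
      rw [hev, ev_smul, ← he] at h1
      linarith
    have hmm : m ≤ m - m * rn M σ (⋃ i, F i) L (t0, hq t0) := by
      exact abs_le'.2 ⟨hup, hlo⟩
    have hr := hLr t0 ht0 hZ
    have hm0 : 0 ≤ m := abs_nonneg _
    nlinarith

end Varg

section Fin
open Filter Topology

theorem inner_eq' {n : ℕ} (w c : EuclideanSpace ℝ (Fin n)) : inner ℝ w c = ∑ i, w i * c i := by
  simp [PiLp.inner_apply, mul_comm]

theorem inner_mixv (M : MDP S Act) {n : ℕ} (w : EuclideanSpace ℝ (Fin n)) (t : S) (l : Act → ℝ)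
    (d : S → EuclideanSpace ℝ (Fin n)) :
    inner ℝ w (mixv M t (l, d)) = ∑ t', wt M t l t' * inner ℝ w (d t') := by
  simp only [mixv, inner_sum, real_inner_smul_right]

theorem D_const (M : MDP S Act) (σ : Strategy M) (s : S) {n : ℕ} (F : Fin n → Set S)
    (hF : ∀ t ∈ ⋃ i, F i, M.IsSink t)
    (hq : S → σ.Q) (hhq : ∀ t ∈ WS M σ s, (t, hq t) ∈ RN M σ s) (L : ℕ)
    (hLr : ∀ t ∈ WS M σ s, t ∉ ZS M σ s F → 0 < rn M σ (⋃ i, F i) L (t, hq t))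
    (g : S → EuclideanSpace ℝ (Fin n))
    (hg0 : ∀ i t, 0 ≤ g t i) (hg1 : ∀ i t, g t i ≤ 1) (hgZ : ∀ i, ∀ t ∈ ZS M σ s F, g t i = 0)
    (hgF : ∀ i, ∀ t ∈ ⋃ i, F i, g t i = ind (F i) t)
    (hgL : ∀ i t, t ∉ ZS M σ s F → g t i = ev M σ L (fun y => g y.1 i) (t, hq t))
    (B : ℝ) (hB : ∀ t, ‖g t‖ ≤ B) (q : EuclideanSpace ℝ (Fin n))
    (hq' : ∀ i, q i = val M σ (F i) (s, σ.init))
    (w : EuclideanSpace ℝ (Fin n))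
    (hw : ∀ ε > 0, ∃ᶠ N in atTop, ∀ c ∈ DN M (AlS M σ s) g N s, inner ℝ w c ≤ inner ℝ w q + ε) :
    ∀ N, ∀ c ∈ DN M (AlS M σ s) g N s, inner ℝ w c = inner ℝ w q := by
  have hen : ∀ t a, AlS M σ s t a → (∑ s', M.P t a s') = 1 := fun t a h => h.1
  have hFi : ∀ i, ∀ t ∈ F i, M.IsSink t := fun i t ht => hF t (Set.mem_iUnion.2 ⟨i, ht⟩)
  have hmax : ∀ N t, ∃ c ∈ DN M (AlS M σ s) g N t, ∀ c' ∈ DN M (AlS M σ s) g N t,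
      inner ℝ w c' ≤ inner ℝ w c := by
    intro N t
    obtain ⟨c, hc, h⟩ := (DN_compact M (AlS M σ s) g N t).exists_isMaxOn
      (DN_nonempty M (AlS M σ s) g (AlS_exists M σ s) N t)
      (f := fun c => inner ℝ w c) (by fun_prop)
    exact ⟨c, hc, fun c' hc' => h hc'⟩
  choose cm hcm hcmax using hmax
  have hB0 : 0 ≤ B := (norm_nonneg _).trans (hB s)
  have hsum0 : 0 ≤ ∑ i, |w i| := Finset.sum_nonneg fun i _ => abs_nonneg _
  have hwB : 0 ≤ ‖w‖ * B := by positivity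
  obtain ⟨V, hVs, hVal, hVg⟩ := V_arg M σ s F hF hq hhq L hLr (fun t => ∑ i, w i * ind (F i) t)
    (fun t => inner ℝ w (g t)) (fun x => ∑ i, w i * val M σ (F i) x) (∑ i, |w i| + ‖w‖ * B)
    (by linarith)
    (by
      intro t ht
      refine Finset.sum_eq_zero fun i _ => ?_
      have : ind (F i) t = 0 := if_neg fun h => ht (Set.mem_iUnion.2 ⟨i, h⟩)
      rw [this, mul_zero])
    (by
      intro m x
      rw [ev_sum]
      refine Finset.sum_congr rfl fun i _ => ?_
      rw [ev_smul, val_ev M σ _ (hFi i)])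
    (by
      intro x
      have hh := val_nonneg M σ (⋃ i, F i) x
      refine (Finset.abs_sum_le_sum_abs _ _).trans ?_
      rw [add_mul, Finset.sum_mul]
      refine le_trans (Finset.sum_le_sum fun i _ => ?_)
        (le_add_of_nonneg_right (mul_nonneg hwB hh))
      rw [abs_mul, abs_of_nonneg (val_nonneg M σ (F i) x)]
      exact mul_le_mul_of_nonneg_left
        (val_mono M σ _ _ (Set.subset_iUnion F i) x) (abs_nonneg _))
    (by
      intro x hx
      refine Finset.sum_congr rfl fun i _ => ?_
      rw [val_sink M σ _ x (hF _ hx)])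
    (by
      intro x
      have : ∀ N, ev M σ N (fun y => ∑ i, w i * ind (F i) y.1) x = ∑ i, w i * rn M σ (F i) N x := by
        intro N
        rw [ev_sum]
        exact Finset.sum_congr rfl fun i _ => by rw [ev_smul]; rfl
      simp only [this]
      exact tendsto_finsetSum _ fun i _ => (rn_tendsto M σ _ (hFi i) x).const_mul _)
    (by
      intro t
      have h := abs_real_inner_le_norm w (g t)
      have h2 := mul_le_mul_of_nonneg_left (hB t) (norm_nonneg w)
      linarith)
    (by
      intro t ht
      simp only [inner_eq', hgZ _ t ht, mul_zero, Finset.sum_const_zero])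
    (by
      intro t ht
      simp only [inner_eq', hgF _ t ht])
    (by
      intro t ht
      simp only [inner_eq']
      rw [ev_sum]
      refine Finset.sum_congr rfl fun i _ => ?_
      rw [ev_smul, ← hgL i t ht])
    (fun N t => inner ℝ w (cm N t))
    (by
      funext t
      have : cm 0 t = g t := hcm 0 t
      rw [this])
    (by
      intro N t
      have h := abs_real_inner_le_norm w (cm N t)
      have h2 := mul_le_mul_of_nonneg_left
        (DN_bdd M (AlS M σ s) g hen B hB N t _ (hcm N t)) (norm_nonneg w)
      linarith)
    (by
      intro N t a ha
      have h := hcmax (N+1) t (mixv M t (Pi.single a 1, cm N))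
        ⟨_, ⟨Lam_single _ t a ha, fun t' _ => hcm N t'⟩, rfl⟩
      rw [inner_mixv] at h
      simpa only [wt_single] using h)
    (by
      intro ε hε
      refine (hw ε hε).mono fun N hN => ?_
      have := hN _ (hcm N s)
      rw [inner_eq' w q] at this
      simpa only [hq'] using this)
  have hVq : V s = inner ℝ w q := by
    rw [hVs, inner_eq']; simp only [hq']
  have key : ∀ N, ∀ t ∈ WS M σ s, ∀ c ∈ DN M (AlS M σ s) g N t, inner ℝ w c = V t := by
    intro N
    induction N with
    | zero => rintro t ht _ rfl; exact hVg t ht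
    | succ N ih =>
      rintro t ht _ ⟨⟨l, d⟩, ⟨hl, hd⟩, rfl⟩
      simp only [Set.mem_univ_pi] at hl hd
      rw [inner_mixv]
      have h1 : ∀ t', wt M t l t' * inner ℝ w (d t') = wt M t l t' * V t' := by
        intro t'
        by_cases h : wt M t l t' = 0
        · rw [h, zero_mul, zero_mul]
        · obtain ⟨a, _, ha⟩ := Finset.exists_ne_zero_of_sum_ne_zero h
          have h2 : l a ≠ 0 := left_ne_zero_of_mul ha
          have h3 : pr M t a t' ≠ 0 := right_ne_zero_of_mul ha
          rw [ih t' (AlS_closed M σ s t ht a (by_contra fun h' => h2 (hl.2.2 a h')) t'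
            (lt_of_le_of_ne (pr_nonneg M _ _ _) h3.symm)) _ (hd t')]
      rw [Finset.sum_congr rfl fun t' _ => h1 t']
      simp only [wt, Finset.sum_mul]
      rw [Finset.sum_comm]
      have h4 : ∀ a, ∑ t', l a * pr M t a t' * V t' = l a * V t := by
        intro a
        by_cases ha : AlS M σ s t a
        · rw [← hVal t ht a ha, Finset.mul_sum]
          exact Finset.sum_congr rfl fun _ _ => by ring
        · simp [hl.2.2 a ha]
      simp only [h4]
      rw [← Finset.sum_mul, hl.2.1, one_mul]
  intro N c hc
  rw [key N s ⟨_, RN_init M σ s⟩ c hc, hVq]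

theorem main_real (M : MDP S Act) (σ : Strategy M) (s : S) {n : ℕ} (F : Fin n → Set S)
    (hF : ∀ t ∈ ⋃ i, F i, M.IsSink t) (φ : S → ℕ) (hs : M.Sure σ s (ParityObj φ)) :
    ∃ τ : Strategy M, τ.FiniteMemory ∧ M.Sure τ s (ParityObj φ) ∧
      ∀ i, val M σ (F i) (s, σ.init) ≤ val M τ (F i) (s, τ.init) := by
  obtain ⟨hq, hhq, hblock⟩ := exists_block M σ s φ hs
  obtain ⟨L, hL, hLr⟩ := exists_L M σ s F hF hq hhq
  choose g1 hg0 hg1 hgZ hgF hgL hgV using fun i => exists_g1 M σ s F hF hq L hL i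
  let g : S → EuclideanSpace ℝ (Fin n) := fun t => WithLp.toLp 2 (fun i => g1 i t)
  let q : EuclideanSpace ℝ (Fin n) := WithLp.toLp 2 (fun i => val M σ (F i) (s, σ.init))
  have hen : ∀ t a, AlS M σ s t a → (∑ s', M.P t a s') = 1 := fun t a h => h.1
  have hB : ∀ t, ‖g t‖ ≤ ∑ t, ‖g t‖ := fun t =>
    Finset.single_le_sum (f := fun t => ‖g t‖) (fun _ _ => norm_nonneg _) (Finset.mem_univ t)
  obtain ⟨N, hN⟩ := convex_hit (fun N => DN M (AlS M σ s) g N s)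
    (fun N => DN_convex M _ g N s) (fun N => DN_compact M _ g N s)
    (fun N => DN_nonempty M _ g (AlS_exists M σ s) N s) (∑ t, ‖g t‖)
    (fun N => DN_bdd M _ g hen _ hB N s) q
    (fun w hw => D_const M σ s F hF hq hhq L hLr g hg0 hg1 hgZ hgF hgL _ hB q (fun i => rfl) w hw)
  choose d hd using DN_nonempty M (AlS M σ s) g (AlS_exists M σ s) N
  have hre : URealizable M φ F (WS M σ s) (fun t i => g t i) :=
    ⟨blockStrat σ hq L hL, blockStrat_finite M σ hq L hL, fun t ht =>
      ⟨hblock L hL t ht, fun i => hgV i t⟩⟩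
  obtain ⟨τ, hfin, hτ⟩ := DN_real M (AlS M σ s) g hen φ F hF (WS M σ s) (AlS_closed M σ s) hre N
    (Function.update d s q) (by
      intro t
      by_cases h : t = s
      · subst h; rw [Function.update_self]; exact hN
      · rw [Function.update_of_ne h]; exact hd t)
  obtain ⟨h1, h2⟩ := hτ s ⟨_, RN_init M σ s⟩
  refine ⟨τ, hfin, h1, fun i => ?_⟩
  have := h2 i
  simp only [Function.update_self] at this
  exact this

end Fin

/-- Theorem 6, strategy complexity: if any strategy surely satisfies the
parity objective and meets `n` non-strict sink-reachability thresholds, then some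
finite-memory strategy does so as well. -/
theorem sure_parity_and_nonstrict_thresholds_finite_memory
    {S Act : Type} [Fintype S] [Nonempty S] [Fintype Act] [Nonempty Act] {n : ℕ}
    (M : MDP S Act) (φ : S → ℕ) (F : Fin n → Set S)
    (hclean_par : M.CleanParity φ) (hclean_tgt : M.CleanTargets F)
    (s : S) (p : Fin n → ℝ) (hp : ∀ i, p i ∈ Set.Icc (0 : ℝ) 1)
    (h : ∃ σ : Strategy M, M.Sure σ s (ParityObj φ) ∧
      ∀ i, ENNReal.ofReal (p i) ≤ M.Pr σ s (ReachObj (F i))) :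
    ∃ σ' : Strategy M, σ'.FiniteMemory ∧ M.Sure σ' s (ParityObj φ) ∧
      ∀ i, ENNReal.ofReal (p i) ≤ M.Pr σ' s (ReachObj (F i)) := by
  obtain ⟨σ, hs, hσ⟩ := h
  have hF := hclean_tgt.1
  have hFi : ∀ i, ∀ t ∈ F i, M.IsSink t := fun i t ht => hF t (Set.mem_iUnion.2 ⟨i, ht⟩)
  obtain ⟨τ, hfin, hsure, hτ⟩ := main_real M σ s F hF φ hs
  refine ⟨τ, hfin, hsure, fun i => (hσ i).trans ?_⟩
  rw [Pr_eq M σ s (F i) (hFi i), Pr_eq M τ s (F i) (hFi i)]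
  exact ENNReal.ofReal_le_ofReal (hτ i)
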